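/- arXiv:math/0607074 — 6 statements merged into one kernel-verified Lean document; each statement's English description precedes it below -/
import Mathlib

section
/- Let K be a field of characteristic zero, N ≥ 1, and k ≥ 1. Let ω be a polynomial differential 2-form on K^N whose coefficients are polynomials of degree ≤ k, such that dω = 0 and the constant term ω(0) ∈ Λ²(K^N)^* is a nondegenerate alternating bilinear form. Then there exists a polynomial map g : K^N → K^N with g(0) = 0 and derivative Dg(0) equal to the identity such that every homogeneous component of degree between 1 and k of the pullback g^*ω vanishes; that is, the components of degree ≤ k of g^*ω coincide with the constant form ω(0). (Formal Darboux theorem: every k-jet of a closed nondegenerate 2-form is equivalent, under a jet of a diffeomorphism fixing 0, to its constant term.) -/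
open MvPolynomial

/-- Antisymmetry of the components of a polynomial differential form. -/
def IsAltC {K : Type} [CommRing K] {n m : ℕ}
    (c : (Fin m → Fin n) → MvPolynomial (Fin n) K) : Prop :=
  ∀ (σ : Equiv.Perm (Fin m)) (i : Fin m → Fin n),
    c (i ∘ σ) = (Equiv.Perm.sign σ : ℤ) • c i

/-- Exterior differential on components. -/
noncomputable def extd {K : Type} [CommRing K] {n m : ℕ}
    (c : (Fin m → Fin n) → MvPolynomial (Fin n) K) :
    (Fin (m + 1) → Fin n) → MvPolynomial (Fin n) K :=
  fun i => ∑ t : Fin (m + 1), ((-1 : K) ^ (t : ℕ)) • pderiv (i t) (c (i ∘ t.succAbove))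

/-- Pullback of a polynomial 2-form (with components `c`) under a polynomial map `g`:
`(g^*ω)_{ab}(x) = Σ_{i,j} ω_{ij}(g(x)) ∂_a g_i ∂_b g_j`, i.e.
`(g^*ω)_x(u,v) = ω_{g(x)}(Dg(x)u, Dg(x)v)`. -/
noncomputable def pull2 {K : Type} [CommRing K] {N : ℕ}
    (g : Fin N → MvPolynomial (Fin N) K)
    (c : (Fin 2 → Fin N) → MvPolynomial (Fin N) K) :
    (Fin 2 → Fin N) → MvPolynomial (Fin N) K :=
  fun ab => ∑ i : Fin N, ∑ j : Fin N,
    bind₁ g (c ![i, j]) * pderiv (ab 0) (g i) * pderiv (ab 1) (g j)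

namespace MvPolynomial

variable {K σ : Type*} [CommRing K]

theorem pderiv_pderiv_comm (i j : σ) (p : MvPolynomial σ K) :
    pderiv i (pderiv j p) = pderiv j (pderiv i p) := by
  classical
  have h : ⁅pderiv (R := K) i, pderiv (R := K) j⁆ = 0 := by
    refine derivation_ext fun l => ?_
    rw [Derivation.commutator_apply]
    simp [pderiv_X, Pi.single_apply, apply_ite]
  have := congrArg (fun D => D p) h
  rwa [Derivation.commutator_apply, Derivation.zero_apply, sub_eq_zero] at this

theorem pderiv_bind₁ [Fintype σ] (g : σ → MvPolynomial σ K) (e : σ) (p : MvPolynomial σ K) :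
    pderiv e (bind₁ g p) = ∑ l, bind₁ g (pderiv l p) * pderiv e (g l) := by
  classical
  induction p using MvPolynomial.induction_on with
  | C a => simp
  | add p q hp hq => simp [hp, hq, add_mul, Finset.sum_add_distrib]
  | mul_X p i hp =>
    have hpi (l : σ) : bind₁ g (pderiv l (p * X i)) * pderiv e (g l) =
        bind₁ g (pderiv l p) * pderiv e (g l) * g i +
          if i = l then bind₁ g p * pderiv e (g l) else 0 := by
      rw [pderiv_mul, pderiv_X, Pi.single_apply]
      split_ifs <;> simp <;> ring
    rw [Finset.sum_congr rfl fun l _ => hpi l]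
    simp [pderiv_mul, hp, Finset.sum_add_distrib, Finset.sum_mul, -Derivation.leibniz]

theorem homogeneousComponent_pderiv (d : ℕ) (i : σ) (p : MvPolynomial σ K) :
    homogeneousComponent d (pderiv i p) = pderiv i (homogeneousComponent (d + 1) p) := by
  ext m
  simp [coeff_homogeneousComponent, coeff_pderiv, map_add]

theorem pderiv_mem_pow_idealOfVars {d : ℕ} {p : MvPolynomial σ K}
    (hp : p ∈ idealOfVars σ K ^ (d + 1)) (i : σ) : pderiv i p ∈ idealOfVars σ K ^ d := by
  rw [mem_pow_idealOfVars_iff'] at hp ⊢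
  intro m hm
  rw [coeff_pderiv, hp _ (by simpa [map_add] using hm), zero_mul]

theorem IsHomogeneous.mem_pow_idealOfVars {d : ℕ} {p : MvPolynomial σ K}
    (hp : p.IsHomogeneous d) : p ∈ idealOfVars σ K ^ d := by
  rw [mem_pow_idealOfVars_iff']
  exact fun m hm => hp.coeff_eq_zero hm.ne

theorem sub_homogeneousComponent_mem_pow_idealOfVars {d : ℕ} {p : MvPolynomial σ K}
    (hp : p ∈ idealOfVars σ K ^ d) :
    p - homogeneousComponent d p ∈ idealOfVars σ K ^ (d + 1) := by
  rw [mem_pow_idealOfVars_iff'] at hp ⊢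
  intro m hm
  rw [coeff_sub, coeff_homogeneousComponent]
  split_ifs with h
  · simp
  · simp [hp m (by lia)]

theorem bind₁_sub_bind₁_mem {J : Ideal (MvPolynomial σ K)} {f g : σ → MvPolynomial σ K}
    (h : ∀ i, f i - g i ∈ J) (p : MvPolynomial σ K) : bind₁ f p - bind₁ g p ∈ J := by
  have : (Ideal.Quotient.mkₐ K J).comp (bind₁ f) = (Ideal.Quotient.mkₐ K J).comp (bind₁ g) := by
    refine algHom_ext fun i => ?_
    simpa using Ideal.Quotient.eq.mpr (h i)
  exact Ideal.Quotient.eq.mp (by simpa using congrArg (fun φ => φ p) this)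

theorem bind₁_sub_C_constantCoeff_mem {J : Ideal (MvPolynomial σ K)} {g : σ → MvPolynomial σ K}
    (h : ∀ i, g i ∈ J) (p : MvPolynomial σ K) : bind₁ g p - C (constantCoeff p) ∈ J := by
  have h0 : bind₁ (0 : σ → MvPolynomial σ K) p = C (constantCoeff p) :=
    (aeval_zero p).trans (by rw [algebraMap_eq])
  simpa [h0] using bind₁_sub_bind₁_mem (f := g) (g := 0) (by simpa using h) p

end MvPolynomial

/-- Poincaré lemma for a closed 2-form with homogeneous components of degree `d`. -/
theorem exists_homogeneous_primitive {K σ : Type*} [Field K] [CharZero K] [Fintype σ] {d : ℕ}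
    {R : σ → σ → MvPolynomial σ K} (hR : ∀ a b, (R a b).IsHomogeneous d)
    (halt : ∀ a b, R b a = -R a b)
    (hclosed : ∀ e a b, pderiv e (R a b) + pderiv a (R b e) + pderiv b (R e a) = 0) :
    ∃ α : σ → MvPolynomial σ K, (∀ a, (α a).IsHomogeneous (d + 1)) ∧
      ∀ a b, pderiv a (α b) - pderiv b (α a) = R a b := by
  classical
  refine ⟨fun b => C ((d + 2 : K)⁻¹) * ∑ e, X e * R e b, fun b => ?_, fun a b => ?_⟩
  · refine IsHomogeneous.C_mul (IsHomogeneous.sum _ _ _ fun e _ => ?_) _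
    rw [add_comm]
    exact (isHomogeneous_X _ _).mul (hR e b)
  · have key (a b : σ) : pderiv a (∑ e, X e * R e b) = R a b + ∑ e, X e * pderiv a (R e b) := by
      simp [pderiv_X, Pi.single_apply, Finset.sum_add_distrib, add_comm]
    have hsum : ∑ e, X e * pderiv a (R e b) - ∑ e, X e * pderiv b (R e a) =
        (d : MvPolynomial σ K) * R a b := by
      rw [← nsmul_eq_mul, ← (hR a b).sum_X_mul_pderiv, ← Finset.sum_sub_distrib]
      refine Finset.sum_congr rfl fun e _ => ?_
      have h := hclosed e a b
      rw [halt e b, map_neg] at h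
      linear_combination (-X e) * h
    have hd : C (σ := σ) ((d + 2 : K)⁻¹) * (d + 2) = 1 := by
      have : (d + 2 : K) ≠ 0 := by exact_mod_cast (by lia : d + 2 ≠ 0)
      have h2 : (d + 2 : MvPolynomial σ K) = C (d + 2 : K) := by
        rw [C_add, map_natCast, map_ofNat]
      rw [h2, ← C_mul, inv_mul_cancel₀ this, C_1]
    simp only [pderiv_C_mul, key]
    rw [halt a b]
    linear_combination (C ((d + 2 : K)⁻¹) : MvPolynomial σ K) * hsum + R a b * hd

/-- Components of the pullback under `g` of the 2-form with components `ω a b`. -/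
noncomputable def pullbackForm {K σ : Type*} [CommRing K] [Fintype σ]
    (g : σ → MvPolynomial σ K) (ω : σ → σ → MvPolynomial σ K) (a b : σ) : MvPolynomial σ K :=
  ∑ i, ∑ j, bind₁ g (ω i j) * pderiv a (g i) * pderiv b (g j)

section pullbackForm

variable {K σ : Type*} [CommRing K] [Fintype σ] {ω : σ → σ → MvPolynomial σ K}

theorem pullbackForm_swap (halt : ∀ a b, ω b a = -ω a b) (g : σ → MvPolynomial σ K) (a b : σ) :
    pullbackForm g ω b a = -pullbackForm g ω a b := by
  rw [pullbackForm, pullbackForm, Finset.sum_comm]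
  simp only [← Finset.sum_neg_distrib]
  refine Finset.sum_congr rfl fun i _ => Finset.sum_congr rfl fun j _ => ?_
  rw [halt i j, map_neg]
  ring

theorem pullbackForm_closed (halt : ∀ a b, ω b a = -ω a b)
    (hclosed : ∀ e a b, pderiv e (ω a b) + pderiv a (ω b e) + pderiv b (ω e a) = 0)
    (g : σ → MvPolynomial σ K) (e a b : σ) :
    pderiv e (pullbackForm g ω a b) + pderiv a (pullbackForm g ω b e) +
      pderiv b (pullbackForm g ω e a) = 0 := by
  set T : σ → σ → σ → MvPolynomial σ K := fun e a b => ∑ i, ∑ j, ∑ l,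
    bind₁ g (pderiv l (ω i j)) * pderiv e (g l) * pderiv a (g i) * pderiv b (g j) with hT
  set U : σ → σ → σ → MvPolynomial σ K := fun e a b => ∑ i, ∑ j,
    bind₁ g (ω i j) * pderiv e (pderiv a (g i)) * pderiv b (g j) with hU
  have hUsymm (e a b) : U e a b = U a e b := by
    simp only [hU, pderiv_pderiv_comm e a]
  have hderiv (e a b) : pderiv e (pullbackForm g ω a b) = T e a b + U e a b - U e b a := by
    have hswap : U e b a = -∑ i, ∑ j,
        bind₁ g (ω i j) * pderiv a (g i) * pderiv e (pderiv b (g j)) := by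
      simp only [hU]
      rw [Finset.sum_comm]
      simp only [← Finset.sum_neg_distrib]
      refine Finset.sum_congr rfl fun i _ => Finset.sum_congr rfl fun j _ => ?_
      rw [halt i j, map_neg]
      ring
    rw [hswap, sub_neg_eq_add]
    simp only [pullbackForm, hT, hU, map_sum, ← Finset.sum_add_distrib]
    refine Finset.sum_congr rfl fun i _ => Finset.sum_congr rfl fun j _ => ?_
    simp only [pderiv_mul, pderiv_bind₁, ← Finset.sum_mul]
    ring
  have hcycle : T e a b + T a b e + T b e a = 0 := by
    have h1 : T a b e = ∑ i, ∑ j, ∑ l,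
        bind₁ g (pderiv i (ω j l)) * pderiv e (g l) * pderiv a (g i) * pderiv b (g j) := by
      simp only [hT]
      rw [Finset.sum_congr rfl fun i _ => Finset.sum_comm, Finset.sum_comm]
      refine Finset.sum_congr rfl fun i _ => Finset.sum_congr rfl fun j _ =>
        Finset.sum_congr rfl fun l _ => ?_
      ring
    have h2 : T b e a = ∑ i, ∑ j, ∑ l,
        bind₁ g (pderiv j (ω l i)) * pderiv e (g l) * pderiv a (g i) * pderiv b (g j) := by
      simp only [hT]
      rw [Finset.sum_comm, Finset.sum_congr rfl fun i _ => Finset.sum_comm]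
      refine Finset.sum_congr rfl fun i _ => Finset.sum_congr rfl fun j _ =>
        Finset.sum_congr rfl fun l _ => ?_
      ring
    rw [h1, h2]
    simp only [hT, ← Finset.sum_add_distrib]
    refine Finset.sum_eq_zero fun i _ => Finset.sum_eq_zero fun j _ =>
      Finset.sum_eq_zero fun l _ => ?_
    have h := congrArg (bind₁ g) (hclosed l i j)
    simp only [map_add, map_zero] at h
    linear_combination (pderiv e (g l) * pderiv a (g i) * pderiv b (g j)) * h
  rw [hderiv, hderiv, hderiv, hUsymm e b a, hUsymm a e b, hUsymm b a e]
  linear_combination hcycle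

/-- First-order effect on a pullback of perturbing the map by `h` of order `d + 2`. -/
theorem pullbackForm_add_sub_mem [DecidableEq σ] {d : ℕ} {g h : σ → MvPolynomial σ K}
    (hg : ∀ i, g i - X i ∈ idealOfVars σ K ^ 2)
    (hh : ∀ i, h i ∈ idealOfVars σ K ^ (d + 2)) (a b : σ) :
    pullbackForm (g + h) ω a b - pullbackForm g ω a b -
      (∑ i, C (constantCoeff (ω i b)) * pderiv a (h i) +
        ∑ j, C (constantCoeff (ω a j)) * pderiv b (h j)) ∈ idealOfVars σ K ^ (d + 2) := by
  set I := idealOfVars σ K with hI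
  have hX (i : σ) : g i ∈ I := by
    have h1 := Ideal.pow_le_self two_ne_zero (hg i)
    have h2 : X i ∈ I := Ideal.subset_span ⟨i, rfl⟩
    simpa using I.add_mem h1 h2
  have hδ (a i : σ) : pderiv a (g i) - (if i = a then 1 else 0) ∈ I := by
    simpa [pderiv_X, Pi.single_apply] using pderiv_mem_pow_idealOfVars (d := 1) (hg i) a
  have hdh (a i : σ) : pderiv a (h i) ∈ I ^ (d + 1) := pderiv_mem_pow_idealOfVars (hh i) a
  have h1 : ∑ i, C (constantCoeff (ω i b)) * pderiv a (h i) =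
      ∑ i, ∑ j, C (constantCoeff (ω i j)) * pderiv a (h i) * (if j = b then 1 else 0) := by
    simp
  have h2 : ∑ j, C (constantCoeff (ω a j)) * pderiv b (h j) =
      ∑ i, ∑ j, C (constantCoeff (ω i j)) * pderiv b (h j) * (if i = a then 1 else 0) := by
    simp
  rw [h1, h2]
  simp only [pullbackForm, ← Finset.sum_add_distrib, ← Finset.sum_sub_distrib]
  refine Ideal.sum_mem _ fun i _ => Ideal.sum_mem _ fun j _ => ?_
  have hω : bind₁ (g + h) (ω i j) - bind₁ g (ω i j) ∈ I ^ (d + 2) :=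
    bind₁_sub_bind₁_mem (by simpa using hh) _
  have hω0 := bind₁_sub_C_constantCoeff_mem hX (ω i j)
  have hmul {p q : MvPolynomial σ K} (hp : p ∈ I ^ (d + 1)) (hq : q ∈ I) : p * q ∈ I ^ (d + 2) :=
    pow_succ I (d + 1) ▸ Ideal.mul_mem_mul hp hq
  have hdI : pderiv b (h j) ∈ I := Ideal.pow_le_self (Nat.succ_ne_zero d) (hdh b j)
  have hu := hmul (hdh a i) (I.add_mem (I.mul_mem_right (pderiv b (g j)) hω0)
    (I.mul_mem_left (C (constantCoeff (ω i j))) (hδ b j)))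
  have hv := hmul (hdh b j) (I.add_mem (I.mul_mem_right (pderiv a (g i)) hω0)
    (I.mul_mem_left (C (constantCoeff (ω i j))) (hδ a i)))
  have huv := (I ^ (d + 2)).mul_mem_left (bind₁ g (ω i j)) (hmul (hdh a i) hdI)
  have hA := (I ^ (d + 2)).mul_mem_right
    (pderiv a ((g + h) i) * pderiv b ((g + h) j)) hω
  convert add_mem (add_mem hA huv) (add_mem hu hv) using 1
  simp only [Pi.add_apply, map_add]
  ring

end pullbackForm

/-- Formal Darboux theorem modulo the `(d + 1)`-st power of the maximal ideal at the origin. -/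
theorem exists_pullbackForm_sub_C_mem {K σ : Type*} [Field K] [CharZero K] [Fintype σ]
    [DecidableEq σ] {ω : σ → σ → MvPolynomial σ K} (halt : ∀ a b, ω b a = -ω a b)
    (hclosed : ∀ e a b, pderiv e (ω a b) + pderiv a (ω b e) + pderiv b (ω e a) = 0)
    (hnondeg : (Matrix.of fun a b => constantCoeff (ω a b)).det ≠ 0) (d : ℕ) :
    ∃ g : σ → MvPolynomial σ K, (∀ i, g i - X i ∈ idealOfVars σ K ^ 2) ∧
      ∀ a b, pullbackForm g ω a b - C (constantCoeff (ω a b)) ∈ idealOfVars σ K ^ (d + 1) := by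
  induction d with
  | zero =>
    refine ⟨X, by simp, fun a b => ?_⟩
    have h : pullbackForm X ω a b = bind₁ X (ω a b) := by
      simp [pullbackForm, pderiv_X, Pi.single_apply]
    rw [h, zero_add, pow_one]
    exact bind₁_sub_C_constantCoeff_mem (fun i => Ideal.subset_span (Set.mem_range_self i)) _
  | succ d ih =>
    obtain ⟨g, hg, hF⟩ := ih
    set M : Matrix σ σ K := Matrix.of fun a b => constantCoeff (ω a b) with hM
    set R : σ → σ → MvPolynomial σ K := fun a b =>
      homogeneousComponent (d + 1) (pullbackForm g ω a b) with hR
    have hC (r : K) : homogeneousComponent (d + 1) (C r : MvPolynomial σ K) = 0 :=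
      homogeneousComponent_eq_zero _ _ (by simp)
    obtain ⟨α, hα, hdα⟩ := exists_homogeneous_primitive (R := R)
      (fun a b => homogeneousComponent_isHomogeneous _ _)
      (fun a b => by simp only [hR, pullbackForm_swap halt g a b, map_neg])
      (fun e a b => by
        simp only [hR, ← homogeneousComponent_pderiv, ← map_add,
          pullbackForm_closed halt hclosed, map_zero])
    set h : σ → MvPolynomial σ K := fun i => ∑ j, C (M⁻¹ i j) * α j with hh
    have hhmem (i : σ) : h i ∈ idealOfVars σ K ^ (d + 2) :=
      Ideal.sum_mem _ fun j _ => Ideal.mul_mem_left _ _ (hα j).mem_pow_idealOfVars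
    have hMh (a : σ) : ∑ i, C (constantCoeff (ω a i)) * h i = α a := by
      have hMM (j : σ) : ∑ i, constantCoeff (ω a i) * M⁻¹ i j = if a = j then 1 else 0 := by
        have := congrFun (congrFun (M.mul_nonsing_inv hnondeg.isUnit) a) j
        rwa [Matrix.mul_apply, Matrix.one_apply] at this
      simp only [hh, Finset.mul_sum, ← mul_assoc, ← C_mul]
      rw [Finset.sum_comm]
      simp only [← Finset.sum_mul, ← map_sum, hMM]
      simp
    refine ⟨g + h, fun i => ?_, fun a b => ?_⟩
    · rw [Pi.add_apply, add_sub_right_comm]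
      exact add_mem (hg i) (Ideal.pow_le_pow_right (by lia) (hhmem i))
    · have hD (a b : σ) : ∑ j, C (constantCoeff (ω a j)) * pderiv b (h j) = pderiv b (α a) := by
        rw [← hMh a, map_sum]
        simp only [pderiv_C_mul]
      have hD' : ∑ i, C (constantCoeff (ω i b)) * pderiv a (h i) = -pderiv a (α b) := by
        rw [← hD b a, ← Finset.sum_neg_distrib]
        refine Finset.sum_congr rfl fun i _ => ?_
        rw [halt b i, map_neg, map_neg, neg_mul]
      have hpert := pullbackForm_add_sub_mem (ω := ω) hg hhmem a b
      rw [hD, hD'] at hpert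
      have hrest := sub_homogeneousComponent_mem_pow_idealOfVars (hF a b)
      rw [map_sub, hC, sub_zero] at hrest
      convert add_mem hpert hrest using 1
      linear_combination -hdα a b

/-- **Formal Darboux theorem.** Every `k`-jet of a closed nondegenerate polynomial 2-form is
equivalent, under a jet of a diffeomorphism fixing `0` (with identity derivative at `0`),
to its constant term: all homogeneous components of degree `1,…,k` of the pullback vanish. -/
theorem formal_darboux (K : Type) [Field K] [CharZero K] (N k : ℕ)
    (hN : 1 ≤ N) (hk : 1 ≤ k)
    (c : (Fin 2 → Fin N) → MvPolynomial (Fin N) K)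
    (halt : IsAltC c)
    (hdeg : ∀ i, (c i).totalDegree ≤ k)
    (hclosed : extd c = 0)
    (hnondeg : (Matrix.of fun a b : Fin N => constantCoeff (c ![a, b])).det ≠ 0) :
    ∃ g : Fin N → MvPolynomial (Fin N) K,
      (∀ i, constantCoeff (g i) = 0) ∧
      (∀ i j : Fin N, (g i).coeff (Finsupp.single j 1) = if i = j then 1 else 0) ∧
      (∀ ab : Fin 2 → Fin N, ∀ d : ℕ, 1 ≤ d → d ≤ k →
        homogeneousComponent d (pull2 g c ab) = 0) := by
  have halt' (a b : Fin N) : c ![b, a] = -c ![a, b] := by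
    have h := halt (Equiv.swap 0 1) ![a, b]
    have h2 : (![a, b] ∘ Equiv.swap 0 1 : Fin 2 → Fin N) = ![b, a] := by
      ext i; fin_cases i <;> simp
    rw [h2, Equiv.Perm.sign_swap (by decide)] at h
    simpa using h
  have hclosed' (e a b : Fin N) : pderiv e (c ![a, b]) + pderiv a (c ![b, e]) +
      pderiv b (c ![e, a]) = 0 := by
    have h := (Fin.sum_univ_three _).symm.trans (congrFun hclosed ![e, a, b])
    have h0 : (![e, a, b] ∘ (0 : Fin 3).succAbove : Fin 2 → Fin N) = ![a, b] := by
      ext i; fin_cases i <;> rfl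
    have h1 : (![e, a, b] ∘ (1 : Fin 3).succAbove : Fin 2 → Fin N) = ![e, b] := by
      ext i; fin_cases i <;> rfl
    have h2 : (![e, a, b] ∘ (2 : Fin 3).succAbove : Fin 2 → Fin N) = ![e, a] := by
      ext i; fin_cases i <;> rfl
    simp only [h0, h1, h2] at h
    rw [halt' e b, map_neg]
    simpa using h
  obtain ⟨g, hg, hF⟩ := exists_pullbackForm_sub_C_mem (ω := fun a b => c ![a, b])
    halt' hclosed' hnondeg k
  simp only [mem_pow_idealOfVars_iff'] at hg hF
  refine ⟨g, fun i => ?_, fun i j => ?_, fun ab d hd hdk => ?_⟩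
  · simpa [constantCoeff_eq] using hg i 0 (by simp)
  · have h := hg i (Finsupp.single j 1) (by simp)
    rw [coeff_sub, sub_eq_zero] at h
    simp [h, coeff_X, Finsupp.single_left_inj]
  · ext m
    rw [coeff_homogeneousComponent, coeff_zero]
    split_ifs with hm
    · have h := hF (ab 0) (ab 1) m (by lia)
      have hm0 : (0 : Fin N →₀ ℕ) ≠ m := by
        rintro rfl
        simp at hm
        lia
      rwa [coeff_sub, coeff_C, if_neg hm0, sub_zero] at h
    · rfl
end

section
/- Let K be a field of characteristic zero, n ≥ 1, k ≥ 0, and let P_k denote the homogeneous polynomials of degree k on K^{2n} with Sp(2n,K) acting by (g·f)(v) = f(g^{-1}v). The space of bilinear maps B : P_k × P_k → K satisfying B(g·f, g·h) = B(f, h) for all g ∈ Sp(2n,K) is one-dimensional: every such B is a scalar multiple of the full contraction pairing B_0(f,h) = Λ^k(f ⊠ h), where f ⊠ h denotes the polynomial f(x)h(y) in two sets of 2n variables, Λ = Σ_{i=1}^n (∂/∂x_i · ∂/∂y_{n+i} − ∂/∂x_{n+i} · ∂/∂y_i), and for f,h of degree k the polynomial Λ^k(f ⊠ h) is a constant; moreover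 B_0 is nonzero. -/
open MvPolynomial Matrix

/-- The matrix entries of the standard symplectic form on `K^{2n}` (written `n + n`). -/
def sympK (K : Type) [Field K] (n : ℕ) : Fin (n + n) → Fin (n + n) → K :=
  fun i j => if (i : ℕ) + n = (j : ℕ) then 1 else if (j : ℕ) + n = (i : ℕ) then -1 else 0

/-- Composition of a polynomial with a linear map: `(polyComp A f)(x) = f (A x)`. -/
noncomputable def polyComp {K : Type} [Field K] {N : ℕ} (A : Matrix (Fin N) (Fin N) K)
    (f : MvPolynomial (Fin N) K) : MvPolynomial (Fin N) K :=
  bind₁ (fun i => ∑ j, C (A i j) * X j) f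

/-- `A` preserves the standard symplectic form: `Aᵀ J A = J`. -/
def IsSymplecticMat (K : Type) [Field K] (n : ℕ)
    (A : Matrix (Fin (n + n)) (Fin (n + n)) K) : Prop :=
  Aᵀ * Matrix.of (sympK K n) * A = Matrix.of (sympK K n)

/-- `f ⊠ h`: the polynomial `f(x)·h(y)` in two sets of `2n` variables. -/
noncomputable def boxProd (K : Type) [Field K] (n : ℕ)
    (f h : MvPolynomial (Fin (n + n)) K) :
    MvPolynomial (Fin (n + n) ⊕ Fin (n + n)) K :=
  rename Sum.inl f * rename Sum.inr h

/-- `Λ = Σ_{i=1}^n (∂/∂x_i · ∂/∂y_{n+i} − ∂/∂x_{n+i} · ∂/∂y_i)`. -/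
noncomputable def lamOp (K : Type) [Field K] (n : ℕ)
    (p : MvPolynomial (Fin (n + n) ⊕ Fin (n + n)) K) :
    MvPolynomial (Fin (n + n) ⊕ Fin (n + n)) K :=
  ∑ i : Fin n,
    (pderiv (Sum.inl (Fin.castAdd n i)) (pderiv (Sum.inr (Fin.natAdd n i)) p)
      - pderiv (Sum.inl (Fin.natAdd n i)) (pderiv (Sum.inr (Fin.castAdd n i)) p))

/-- The full contraction pairing `B_0(f,h) = Λ^k (f ⊠ h)` (a constant, extracted as the
constant coefficient). -/
noncomputable def fullContraction (K : Type) [Field K] (n k : ℕ)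
    (f h : MvPolynomial (Fin (n + n)) K) : K :=
  constantCoeff ((lamOp K n)^[k] (boxProd K n f h))

/-- The linear form with coefficient vector `a`. -/
noncomputable def linForm {K : Type} [Field K] {N : ℕ} (a : Fin N → K) :
    MvPolynomial (Fin N) K :=
  ∑ j, C (a j) * X j

/-- The monomial with exponents `α`. -/
noncomputable def funMonomial (K : Type) [Field K] {N : ℕ} (α : Fin N → ℕ) :
    MvPolynomial (Fin N) K :=
  monomial (Finsupp.equivFunOnFinite.symm α) 1

theorem linForm_isHomogeneous {K : Type} [Field K] {N : ℕ} (a : Fin N → K) :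
    (linForm a).IsHomogeneous 1 :=
  IsHomogeneous.sum _ _ _ fun j _ => by
    simpa using (isHomogeneous_C _ (a j)).mul (isHomogeneous_X K j)

theorem linForm_pow_isHomogeneous {K : Type} [Field K] {N : ℕ} (a : Fin N → K) (k : ℕ) :
    (linForm a ^ k).IsHomogeneous k := by
  simpa using (linForm_isHomogeneous a).pow k

theorem linForm_smul {K : Type} [Field K] {N : ℕ} (s : K) (a : Fin N → K) :
    linForm (s • a) = s • linForm a := by
  simp [linForm, Finset.smul_sum, smul_eq_C_mul, mul_assoc]

theorem polyComp_linForm {K : Type} [Field K] {N : ℕ} (A : Matrix (Fin N) (Fin N) K)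
    (a : Fin N → K) : polyComp A (linForm a) = linForm (a ᵥ* A) := by
  simp only [polyComp, linForm, map_sum, map_mul, bind₁_X_right, algHom_C, vecMul, dotProduct,
    Finset.sum_mul, Finset.mul_sum, algebraMap_eq]
  rw [Finset.sum_comm]
  simp [mul_assoc]

theorem linForm_pow_eq_sum {K : Type} [Field K] {N : ℕ} (a : Fin N → K) (k : ℕ) :
    linForm a ^ k = ∑ α ∈ Finset.piAntidiag Finset.univ k,
      ((Nat.multinomial Finset.univ α : K) * ∏ i, a i ^ α i) • funMonomial K α := by
  rw [linForm, Finset.sum_pow_eq_sum_piAntidiag]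
  refine Finset.sum_congr rfl fun α _ => ?_
  rw [funMonomial, monomial_eq, Finsupp.prod_fintype _ _ (by simp)]
  simp [smul_eq_C_mul, mul_pow, Finset.prod_mul_distrib, mul_assoc]

/-- A bilinear map killing the pairs `(ℓᵏ, mᵏ)` for generic linear forms `ℓ`, `m` vanishes on
homogeneous polynomials of degree `k`. -/
theorem bilin_eq_zero_of_linForm_pow {K : Type} [Field K] [CharZero K] {N : ℕ} (k : ℕ)
    (D : MvPolynomial (Fin N) K →ₗ[K] MvPolynomial (Fin N) K →ₗ[K] K)
    (Q : MvPolynomial (Fin N ⊕ Fin N) K) (hQ : Q ≠ 0)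
    (hD : ∀ a b : Fin N → K, eval (Sum.elim a b) Q ≠ 0 → D (linForm a ^ k) (linForm b ^ k) = 0)
    (f h : MvPolynomial (Fin N) K) (hf : f.IsHomogeneous k) (hh : h.IsHomogeneous k) :
    D f h = 0 := by
  classical
  set S := Finset.piAntidiag (Finset.univ : Finset (Fin N)) k with hS
  let e : (Fin N → ℕ) × (Fin N → ℕ) → (Fin N ⊕ Fin N →₀ ℕ) :=
    fun p => Finsupp.equivFunOnFinite.symm (Sum.elim p.1 p.2)
  have he : Function.Injective e := by
    intro p q hpq
    have := Finsupp.equivFunOnFinite.symm.injective hpq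
    refine Prod.ext (funext fun i => ?_) (funext fun i => ?_)
    · simpa using congrFun this (Sum.inl i)
    · simpa using congrFun this (Sum.inr i)
  let w : (Fin N → ℕ) × (Fin N → ℕ) → K := fun p =>
    (Nat.multinomial Finset.univ p.1 : K) * (Nat.multinomial Finset.univ p.2 : K) *
      D (funMonomial K p.1) (funMonomial K p.2)
  let P : MvPolynomial (Fin N ⊕ Fin N) K := ∑ p ∈ S ×ˢ S, monomial (e p) (w p)
  have hP : ∀ a b : Fin N → K,
      eval (Sum.elim a b) P = D (linForm a ^ k) (linForm b ^ k) := by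
    intro a b
    rw [linForm_pow_eq_sum, linForm_pow_eq_sum, ← hS]
    simp only [P, map_sum, LinearMap.sum_apply, map_smul, LinearMap.smul_apply,
      Finset.sum_product, eval_monomial]
    rw [Finset.sum_comm]
    refine Finset.sum_congr rfl fun β _ => ?_
    rw [Finset.smul_sum]
    refine Finset.sum_congr rfl fun α _ => ?_
    rw [Finsupp.prod_fintype _ _ (by simp), Fintype.prod_sum_type]
    simp [e, w]
    ring
  have hPQ : P * Q = 0 := by
    refine MvPolynomial.funext fun x => ?_
    obtain ⟨a, b, rfl⟩ : ∃ a b, x = Sum.elim a b :=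
      ⟨x ∘ Sum.inl, x ∘ Sum.inr, (Sum.elim_comp_inl_inr x).symm⟩
    by_cases hx : eval (Sum.elim a b) Q = 0
    · simp [hx]
    · simp [hP, hD a b hx]
  have hP0 : P = 0 := (mul_eq_zero.mp hPQ).resolve_right hQ
  have hmon : ∀ α ∈ S, ∀ β ∈ S, D (funMonomial K α) (funMonomial K β) = 0 := by
    intro α hα β hβ
    have hc := congrArg (coeff (e (α, β))) hP0
    simp only [P, coeff_sum, coeff_monomial, he.eq_iff, coeff_zero] at hc
    rw [Finset.sum_ite_eq' (S ×ˢ S) (α, β), if_pos (Finset.mk_mem_product hα hβ)] at hc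
    simpa [w, (Nat.multinomial_pos Finset.univ α).ne', (Nat.multinomial_pos Finset.univ β).ne']
      using hc
  have hexp : ∀ g : MvPolynomial (Fin N) K, g.IsHomogeneous k →
      ∀ d ∈ g.support, (d : Fin N → ℕ) ∈ S := by
    intro g hg d hd
    rw [hS, Finset.mem_piAntidiag]
    refine ⟨?_, by simp⟩
    rw [← Finsupp.degree_eq_sum]
    by_contra hne
    exact (mem_support_iff.mp hd) (hg.coeff_eq_zero hne)
  have hform : ∀ g : MvPolynomial (Fin N) K,
      g = ∑ d ∈ g.support, coeff d g • funMonomial K (d : Fin N → ℕ) := by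
    intro g
    conv_lhs => rw [g.as_sum]
    exact Finset.sum_congr rfl fun d _ => by simp [funMonomial, smul_monomial]
  rw [hform f, hform h]
  simp only [map_sum, LinearMap.sum_apply, map_smul, LinearMap.smul_apply]
  refine Finset.sum_eq_zero fun d hd => ?_
  rw [Finset.sum_eq_zero fun d' hd' => ?_, smul_zero]
  rw [hmon _ (hexp f hf d' hd') _ (hexp h hh d hd), smul_zero]

/-- The standard symplectic form on coefficient vectors. -/
def sympForm {K : Type} [Field K] {n : ℕ} (a b : Fin (n + n) → K) : K :=
  ∑ i : Fin n, (a (Fin.castAdd n i) * b (Fin.natAdd n i)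
    - a (Fin.natAdd n i) * b (Fin.castAdd n i))

theorem sympK_mulVec_castAdd {K : Type} [Field K] {n : ℕ} (u : Fin (n + n) → K) (i : Fin n) :
    (Matrix.of (sympK K n) *ᵥ u) (Fin.castAdd n i) = u (Fin.natAdd n i) := by
  have h1 : ∀ j : Fin n, sympK K n (Fin.castAdd n i) (Fin.castAdd n j) = 0 := fun j => by
    simp only [sympK, Fin.val_castAdd]
    rw [if_neg (by omega), if_neg (by omega)]
  have h2 : ∀ j : Fin n, sympK K n (Fin.castAdd n i) (Fin.natAdd n j)
      = if i = j then 1 else 0 := fun j => by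
    simp only [sympK, Fin.val_castAdd, Fin.val_natAdd, Fin.ext_iff]
    split_ifs <;> first | rfl | omega
  simp [mulVec, dotProduct, Fin.sum_univ_add, h1, h2, -Fin.natAdd_eq_addNat]

theorem sympK_mulVec_natAdd {K : Type} [Field K] {n : ℕ} (u : Fin (n + n) → K) (i : Fin n) :
    (Matrix.of (sympK K n) *ᵥ u) (Fin.natAdd n i) = - u (Fin.castAdd n i) := by
  have h1 : ∀ j : Fin n, sympK K n (Fin.natAdd n i) (Fin.natAdd n j) = 0 := fun j => by
    simp only [sympK, Fin.val_natAdd]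
    rw [if_neg (by omega), if_neg (by omega)]
  have h2 : ∀ j : Fin n, sympK K n (Fin.natAdd n i) (Fin.castAdd n j)
      = if i = j then -1 else 0 := fun j => by
    simp only [sympK, Fin.val_castAdd, Fin.val_natAdd, Fin.ext_iff]
    split_ifs <;> first | rfl | omega
  simp [mulVec, dotProduct, Fin.sum_univ_add, h1, h2, -Fin.natAdd_eq_addNat]

theorem dotProduct_sympK_mulVec {K : Type} [Field K] {n : ℕ} (a b : Fin (n + n) → K) :
    a ⬝ᵥ (Matrix.of (sympK K n) *ᵥ b) = sympForm a b := by
  rw [dotProduct, Fin.sum_univ_add]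
  simp [sympK_mulVec_castAdd, sympK_mulVec_natAdd, sympForm, sub_eq_add_neg,
    Finset.sum_add_distrib, -Fin.natAdd_eq_addNat]

theorem sympK_mulVec_mulVec {K : Type} [Field K] {n : ℕ} (u : Fin (n + n) → K) :
    Matrix.of (sympK K n) *ᵥ (Matrix.of (sympK K n) *ᵥ u) = -u := by
  funext i
  refine Fin.addCases (fun i => ?_) (fun i => ?_) i
  · simp only [sympK_mulVec_castAdd, sympK_mulVec_natAdd, Pi.neg_apply]
  · simp only [sympK_mulVec_castAdd, sympK_mulVec_natAdd, Pi.neg_apply]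

theorem sympK_transpose {K : Type} [Field K] {n : ℕ} :
    (Matrix.of (sympK K n))ᵀ = -Matrix.of (sympK K n) := by
  ext i j
  rw [Matrix.neg_apply]
  simp only [transpose_apply, of_apply, sympK]
  split_ifs <;> first | omega | simp

theorem sympForm_self {K : Type} [Field K] {n : ℕ} (a : Fin (n + n) → K) :
    sympForm a a = 0 :=
  Finset.sum_eq_zero fun i _ => by ring

theorem sympForm_swap {K : Type} [Field K] {n : ℕ} (a b : Fin (n + n) → K) :
    sympForm b a = -sympForm a b := by
  rw [sympForm, sympForm, ← Finset.sum_neg_distrib]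
  exact Finset.sum_congr rfl fun i _ => by ring

theorem sympForm_smul_right {K : Type} [Field K] {n : ℕ} (s : K) (a b : Fin (n + n) → K) :
    sympForm a (s • b) = s * sympForm a b := by
  rw [← dotProduct_sympK_mulVec, ← dotProduct_sympK_mulVec, mulVec_smul, dotProduct_smul,
    smul_eq_mul]

theorem sympForm_sub_right {K : Type} [Field K] {n : ℕ} (a b c : Fin (n + n) → K) :
    sympForm a (b - c) = sympForm a b - sympForm a c := by
  simp only [← dotProduct_sympK_mulVec, mulVec_sub, dotProduct_sub]

/-- The matrix of the symplectic transvection `a ↦ a + c ω(a, u) u` on coefficient vectors. -/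
def transvectionMat {K : Type} [Field K] {n : ℕ} (c : K) (u : Fin (n + n) → K) :
    Matrix (Fin (n + n)) (Fin (n + n)) K :=
  1 + c • vecMulVec (Matrix.of (sympK K n) *ᵥ u) u

theorem vecMul_transvectionMat {K : Type} [Field K] {n : ℕ} (c : K) (a u : Fin (n + n) → K) :
    a ᵥ* transvectionMat c u = a + (c * sympForm a u) • u := by
  rw [transvectionMat, vecMul_add, vecMul_one, vecMul_smul, vecMul_vecMulVec,
    dotProduct_sympK_mulVec, smul_smul]

theorem isSymplecticMat_transvectionMat {K : Type} [Field K] {n : ℕ} (c : K)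
    (u : Fin (n + n) → K) : IsSymplecticMat K n (transvectionMat c u) := by
  have h1 : (Matrix.of (sympK K n) *ᵥ u) ᵥ* Matrix.of (sympK K n) = u := by
    rw [← mulVec_transpose, sympK_transpose, neg_mulVec, sympK_mulVec_mulVec, neg_neg]
  have h2 : u ⬝ᵥ (Matrix.of (sympK K n) *ᵥ u) = 0 := by
    rw [dotProduct_sympK_mulVec, sympForm_self]
  simp only [IsSymplecticMat, transvectionMat, transpose_add, transpose_one, transpose_smul,
    transpose_vecMulVec, add_mul, mul_add, one_mul, mul_one, smul_mul_assoc, mul_smul_comm,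
    vecMulVec_mul, mul_vecMulVec, sympK_mulVec_mulVec, h1, vecMulVec_mulVec, h2]
  simp [neg_vecMulVec]

/-- Changing the second vector of a pair by a transvection fixing the first one. -/
theorem invariant_eq_of_right {K : Type} [Field K] {n : ℕ}
    (F : (Fin (n + n) → K) → (Fin (n + n) → K) → K)
    (hF : ∀ (c : K) (u a b : Fin (n + n) → K),
      F (a ᵥ* transvectionMat c u) (b ᵥ* transvectionMat c u) = F a b)
    {a b b' : Fin (n + n) → K} (hab : sympForm a b = sympForm a b')
    (hb : sympForm b b' ≠ 0) : F a b = F a b' := by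
  have h := hF (sympForm b b')⁻¹ (b' - b) a b
  rw [vecMul_transvectionMat, vecMul_transvectionMat, sympForm_sub_right, sympForm_sub_right,
    hab, sympForm_self, sub_self, sub_zero, inv_mul_cancel₀ hb] at h
  simpa using h.symm

theorem invariant_mul_pow_right {K : Type} [Field K] {n : ℕ} (k : ℕ)
    (F : (Fin (n + n) → K) → (Fin (n + n) → K) → K)
    (hF : ∀ (c : K) (u a b : Fin (n + n) → K),
      F (a ᵥ* transvectionMat c u) (b ᵥ* transvectionMat c u) = F a b)
    (hs : ∀ (s : K) (a b : Fin (n + n) → K), F a (s • b) = s ^ k * F a b)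
    {a b b' : Fin (n + n) → K} (hab : sympForm a b ≠ 0) (hab' : sympForm a b' ≠ 0)
    (hb : sympForm b b' ≠ 0) : F a b * sympForm a b' ^ k = F a b' * sympForm a b ^ k := by
  have hne : sympForm a b / sympForm a b' ≠ 0 := div_ne_zero hab hab'
  have h := invariant_eq_of_right F hF (a := a) (b := b)
    (b' := (sympForm a b / sympForm a b') • b')
    (by rw [sympForm_smul_right, div_mul_cancel₀ _ hab'])
    (by rw [sympForm_smul_right]; exact mul_ne_zero hne hb)
  rw [h, hs, div_pow]
  field_simp

/-- A function of pairs that is invariant under transvections and homogeneous of degree `k` in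
each argument is generically a multiple of the `k`-th power of the symplectic form. -/
theorem invariant_eq_sympForm_pow {K : Type} [Field K] {n : ℕ} (k : ℕ)
    (F : (Fin (n + n) → K) → (Fin (n + n) → K) → K)
    (hF : ∀ (c : K) (u a b : Fin (n + n) → K),
      F (a ᵥ* transvectionMat c u) (b ᵥ* transvectionMat c u) = F a b)
    (hl : ∀ (s : K) (a b : Fin (n + n) → K), F (s • a) b = s ^ k * F a b)
    (hr : ∀ (s : K) (a b : Fin (n + n) → K), F a (s • b) = s ^ k * F a b)
    {e f a b : Fin (n + n) → K} (hef : sympForm e f = 1) (haf : sympForm a f ≠ 0)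
    (hea : sympForm e a ≠ 0) (hab : sympForm a b ≠ 0) (hfb : sympForm f b ≠ 0) :
    F a b = F e f * sympForm a b ^ k := by
  have h1 := invariant_mul_pow_right k F hF hr haf hab hfb
  have h2 := invariant_mul_pow_right k (fun x y => F y x) (fun c u x y => hF c u y x)
    (fun s x y => hl s y x) (a := f) (b := e) (b' := a)
    (by rw [sympForm_swap, hef]; simp) (by rw [sympForm_swap]; simpa using haf) hea
  simp only [sympForm_swap e f, sympForm_swap a f, hef] at h2
  have h3 : F a f = F e f * sympForm a f ^ k := by
    have h4 : (-1 : K) ^ k ≠ 0 := pow_ne_zero _ (by simp)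
    rw [neg_pow (sympForm a f)] at h2
    apply mul_right_cancel₀ h4
    linear_combination -h2
  rw [h3] at h1
  apply mul_right_cancel₀ (pow_ne_zero k haf)
  linear_combination -h1

/-- The operator `Λ` as a linear map. -/
noncomputable def lamLin (K : Type) [Field K] (n : ℕ) :
    MvPolynomial (Fin (n + n) ⊕ Fin (n + n)) K →ₗ[K]
      MvPolynomial (Fin (n + n) ⊕ Fin (n + n)) K where
  toFun := lamOp K n
  map_add' p q := by
    simp only [lamOp, map_add, ← Finset.sum_add_distrib]
    exact Finset.sum_congr rfl fun i _ => by ring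
  map_smul' c p := by
    simp only [lamOp, Derivation.map_smul, Finset.smul_sum, smul_sub, RingHom.id_apply]

/-- The full contraction pairing as a bilinear map. -/
noncomputable def contractionBilin (K : Type) [Field K] (n k : ℕ) :
    MvPolynomial (Fin (n + n)) K →ₗ[K] MvPolynomial (Fin (n + n)) K →ₗ[K] K :=
  ((LinearMap.mul K (MvPolynomial (Fin (n + n) ⊕ Fin (n + n)) K)).compl₁₂
    (rename Sum.inl).toLinearMap (rename Sum.inr).toLinearMap).compr₂
    ((lcoeff K 0) ∘ₗ (lamLin K n) ^ k)

theorem contractionBilin_apply (K : Type) [Field K] (n k : ℕ)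
    (f h : MvPolynomial (Fin (n + n)) K) :
    contractionBilin K n k f h = fullContraction K n k f h := by
  simp only [contractionBilin, fullContraction, LinearMap.compr₂_apply, LinearMap.compl₁₂_apply,
    LinearMap.comp_apply, Module.End.pow_apply, constantCoeff_eq]
  rfl

theorem lamOp_isHomogeneous {K : Type} [Field K] {n m : ℕ}
    {p : MvPolynomial (Fin (n + n) ⊕ Fin (n + n)) K} (hp : p.IsHomogeneous (m + 2)) :
    (lamOp K n p).IsHomogeneous m :=
  IsHomogeneous.sum _ _ _ fun _ _ => (hp.pderiv.pderiv).sub (hp.pderiv.pderiv)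

theorem lamOp_iterate_isHomogeneous {K : Type} [Field K] {n : ℕ} (k : ℕ) :
    ∀ {p : MvPolynomial (Fin (n + n) ⊕ Fin (n + n)) K}, p.IsHomogeneous (k + k) →
      ((lamOp K n)^[k] p).IsHomogeneous 0 := by
  induction k with
  | zero => exact fun hp => hp
  | succ k ih =>
    intro p hp
    rw [Function.iterate_succ_apply]
    exact ih (lamOp_isHomogeneous (by convert hp using 1; ring))

theorem pderiv_boxProd_linForm {K : Type} [Field K] {n : ℕ} (a b : Fin (n + n) → K)
    (i j : Fin (n + n)) (k : ℕ) :
    pderiv (Sum.inl i) (pderiv (Sum.inr j)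
      (boxProd K n (linForm a ^ (k + 1)) (linForm b ^ (k + 1)))) =
      (((k : K) + 1) ^ 2 * (a i * b j)) • boxProd K n (linForm a ^ k) (linForm b ^ k) := by
  classical
  have ha1 : pderiv (R := K) (Sum.inl i) (rename (Sum.inl : _ → Fin (n + n) ⊕ Fin (n + n))
      (linForm a)) = C (a i) := by
    simp [linForm, pderiv_X, Pi.single_apply]
  have ha2 : pderiv (R := K) (Sum.inr j) (rename (Sum.inl : _ → Fin (n + n) ⊕ Fin (n + n))
      (linForm a)) = 0 := by
    simp [linForm, pderiv_X]
  have hb1 : pderiv (R := K) (Sum.inr j) (rename (Sum.inr : _ → Fin (n + n) ⊕ Fin (n + n))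
      (linForm b)) = C (b j) := by
    simp [linForm, pderiv_X, Pi.single_apply]
  have hb2 : pderiv (R := K) (Sum.inl i) (rename (Sum.inr : _ → Fin (n + n) ⊕ Fin (n + n))
      (linForm b)) = 0 := by
    simp [linForm, pderiv_X]
  simp only [boxProd, map_pow, pderiv_mul, pderiv_pow, ha1, ha2, hb1, hb2, pderiv_C,
    smul_eq_C_mul, map_mul, map_add, map_natCast, map_one, Nat.add_sub_cancel]
  simp
  ring

theorem lamOp_boxProd_linForm {K : Type} [Field K] {n : ℕ} (a b : Fin (n + n) → K) (k : ℕ) :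
    lamOp K n (boxProd K n (linForm a ^ (k + 1)) (linForm b ^ (k + 1))) =
      (((k : K) + 1) ^ 2 * sympForm a b) • boxProd K n (linForm a ^ k) (linForm b ^ k) := by
  simp only [lamOp, pderiv_boxProd_linForm, sympForm, Finset.mul_sum, Finset.sum_smul, mul_sub,
    sub_smul]

theorem fullContraction_linForm {K : Type} [Field K] {n : ℕ} (a b : Fin (n + n) → K) (k : ℕ) :
    fullContraction K n k (linForm a ^ k) (linForm b ^ k) =
      (k.factorial : K) ^ 2 * sympForm a b ^ k := by
  induction k with
  | zero => simp [fullContraction, boxProd]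
  | succ k ih =>
    have hsmul : ∀ (c : K) (p : MvPolynomial (Fin (n + n) ⊕ Fin (n + n)) K),
        (lamOp K n)^[k] (c • p) = c • (lamOp K n)^[k] p := fun c p => by
      have h := ((lamLin K n) ^ k).map_smul c p
      rwa [Module.End.pow_apply, Module.End.pow_apply] at h
    rw [fullContraction] at ih ⊢
    rw [Function.iterate_succ_apply, lamOp_boxProd_linForm, hsmul, constantCoeff_smul, ih,
      Nat.factorial_succ]
    push_cast
    simp only [smul_eq_mul]
    ring

/-- The symplectic form as a polynomial in the coordinates of two vectors. -/
noncomputable def sympFormPoly (K : Type) [Field K] (n : ℕ) :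
    MvPolynomial (Fin (n + n) ⊕ Fin (n + n)) K :=
  ∑ i : Fin n, (X (Sum.inl (Fin.castAdd n i)) * X (Sum.inr (Fin.natAdd n i))
    - X (Sum.inl (Fin.natAdd n i)) * X (Sum.inr (Fin.castAdd n i)))

theorem eval_sympFormPoly {K : Type} [Field K] {n : ℕ} (a b : Fin (n + n) → K) :
    eval (Sum.elim a b) (sympFormPoly K n) = sympForm a b := by
  simp [sympFormPoly, sympForm]

theorem sympForm_single_castAdd_left {K : Type} [Field K] {n : ℕ} (i : Fin n)
    (a : Fin (n + n) → K) :
    sympForm (Pi.single (Fin.castAdd n i) 1) a = a (Fin.natAdd n i) := by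
  rw [← dotProduct_sympK_mulVec, single_one_dotProduct, sympK_mulVec_castAdd]

theorem sympForm_single_natAdd_left {K : Type} [Field K] {n : ℕ} (i : Fin n)
    (a : Fin (n + n) → K) :
    sympForm (Pi.single (Fin.natAdd n i) 1) a = -a (Fin.castAdd n i) := by
  rw [← dotProduct_sympK_mulVec, single_one_dotProduct, sympK_mulVec_natAdd]

/-- The projection of a polynomial onto its homogeneous component of degree `k`. -/
noncomputable def homogeneousProj (K : Type) [Field K] (N k : ℕ) :
    MvPolynomial (Fin N) K →ₗ[K] homogeneousSubmodule (Fin N) K k :=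
  (homogeneousComponent k).codRestrict _ fun f => homogeneousComponent_isHomogeneous k f

theorem homogeneousProj_of_isHomogeneous {K : Type} [Field K] {N k : ℕ}
    {f : MvPolynomial (Fin N) K} (hf : f.IsHomogeneous k) :
    homogeneousProj K N k f = ⟨f, hf⟩ :=
  Subtype.ext <| (homogeneousComponent_of_mem hf).trans (if_pos rfl)

/-- The space of `Sp(2n,K)`-invariant bilinear maps `P_k × P_k → K` is one-dimensional,
spanned by the full contraction pairing `B_0(f,h) = Λ^k(f ⊠ h)`:
(a) for `f,h` homogeneous of degree `k` the polynomial `Λ^k (f ⊠ h)` is a constant;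
(b) `B_0` is nonzero on `P_k × P_k`;
(c) every invariant bilinear map `B : P_k × P_k → K` is a scalar multiple of `B_0`. -/
theorem invariant_pairing_unique (K : Type) [Field K] [CharZero K]
    (n k : ℕ) (hn : 1 ≤ n) :
    (∀ f h : MvPolynomial (Fin (n + n)) K, f.IsHomogeneous k → h.IsHomogeneous k →
      ∃ cst : K, (lamOp K n)^[k] (boxProd K n f h) = C cst) ∧
    (∃ f h : MvPolynomial (Fin (n + n)) K, f.IsHomogeneous k ∧ h.IsHomogeneous k ∧
      fullContraction K n k f h ≠ 0) ∧
    (∀ B : (homogeneousSubmodule (Fin (n + n)) K k) →ₗ[K]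
           (homogeneousSubmodule (Fin (n + n)) K k) →ₗ[K] K,
      (∀ A : Matrix (Fin (n + n)) (Fin (n + n)) K, IsSymplecticMat K n A →
        ∀ (f f' h h' : homogeneousSubmodule (Fin (n + n)) K k),
          (f' : MvPolynomial (Fin (n + n)) K) = polyComp A (f : MvPolynomial (Fin (n + n)) K) →
          (h' : MvPolynomial (Fin (n + n)) K) = polyComp A (h : MvPolynomial (Fin (n + n)) K) →
          B f' h' = B f h) →
      ∃ cB : K, ∀ f h : homogeneousSubmodule (Fin (n + n)) K k,
        B f h = cB * fullContraction K n k (f : MvPolynomial (Fin (n + n)) K)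
          (h : MvPolynomial (Fin (n + n)) K)) := by
  set i₀ : Fin n := ⟨0, hn⟩
  set e : Fin (n + n) → K := Pi.single (Fin.castAdd n i₀) 1 with he
  set f₀ : Fin (n + n) → K := Pi.single (Fin.natAdd n i₀) 1 with hf₀
  have hef : sympForm e f₀ = 1 := by
    rw [he, sympForm_single_castAdd_left, hf₀, Pi.single_eq_same]
  have hk : ((k.factorial : K)) ≠ 0 := by exact_mod_cast k.factorial_ne_zero
  refine ⟨fun f h hf hh => ?_, ⟨linForm e ^ k, linForm f₀ ^ k, linForm_pow_isHomogeneous _ _,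
    linForm_pow_isHomogeneous _ _, ?_⟩, fun B hB => ?_⟩
  · have hbox : (boxProd K n f h).IsHomogeneous (k + k) :=
      (hf.rename_isHomogeneous).mul (hh.rename_isHomogeneous)
    exact ⟨_, totalDegree_eq_zero_iff_eq_C.mp
      ((totalDegree_zero_iff_isHomogeneous _).mpr (lamOp_iterate_isHomogeneous k hbox))⟩
  · rw [fullContraction_linForm, hef]
    simpa using hk
  let F : (Fin (n + n) → K) → (Fin (n + n) → K) → K := fun a b =>
    B ⟨linForm a ^ k, linForm_pow_isHomogeneous a k⟩ ⟨linForm b ^ k, linForm_pow_isHomogeneous b k⟩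
  have hF : ∀ (c : K) (u a b : Fin (n + n) → K),
      F (a ᵥ* transvectionMat c u) (b ᵥ* transvectionMat c u) = F a b := fun c u a b =>
    hB _ (isSymplecticMat_transvectionMat c u) _ _ _ _
      (by simp [← polyComp_linForm, polyComp]) (by simp [← polyComp_linForm, polyComp])
  have hpow : ∀ (s : K) (a : Fin (n + n) → K),
      (⟨linForm (s • a) ^ k, linForm_pow_isHomogeneous _ k⟩ :
        homogeneousSubmodule (Fin (n + n)) K k) =
      s ^ k • ⟨linForm a ^ k, linForm_pow_isHomogeneous a k⟩ := fun s a =>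
    Subtype.ext (by simp [linForm_smul, smul_pow])
  have hl : ∀ (s : K) (a b : Fin (n + n) → K), F (s • a) b = s ^ k * F a b := fun s a b => by
    simp only [F, hpow, map_smul, LinearMap.smul_apply, smul_eq_mul]
  have hr : ∀ (s : K) (a b : Fin (n + n) → K), F a (s • b) = s ^ k * F a b := fun s a b => by
    simp only [F, hpow, map_smul, smul_eq_mul]
  set cB : K := F e f₀ / (k.factorial : K) ^ 2 with hcB
  let D : MvPolynomial (Fin (n + n)) K →ₗ[K] MvPolynomial (Fin (n + n)) K →ₗ[K] K :=
    B.compl₁₂ (homogeneousProj K (n + n) k) (homogeneousProj K (n + n) k)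
      - cB • contractionBilin K n k
  have hDapp : ∀ f h : MvPolynomial (Fin (n + n)) K, ∀ (hf : f.IsHomogeneous k)
      (hh : h.IsHomogeneous k), D f h = B ⟨f, hf⟩ ⟨h, hh⟩ - cB * fullContraction K n k f h :=
    fun f h hf hh => by
      simp [D, contractionBilin_apply, homogeneousProj_of_isHomogeneous hf,
        homogeneousProj_of_isHomogeneous hh]
  let Q : MvPolynomial (Fin (n + n) ⊕ Fin (n + n)) K :=
    X (Sum.inl (Fin.castAdd n i₀)) * X (Sum.inl (Fin.natAdd n i₀)) *
      X (Sum.inr (Fin.castAdd n i₀)) * sympFormPoly K n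
  have hQ : Q ≠ 0 := by
    refine mul_ne_zero (mul_ne_zero (mul_ne_zero (X_ne_zero _) (X_ne_zero _)) (X_ne_zero _)) ?_
    intro h0
    have := eval_sympFormPoly e f₀
    rw [h0, hef] at this
    simp at this
  have hgen : ∀ a b : Fin (n + n) → K, eval (Sum.elim a b) Q ≠ 0 →
      D (linForm a ^ k) (linForm b ^ k) = 0 := by
    intro a b hab
    simp only [Q, map_mul, eval_X, Sum.elim_inl, Sum.elim_inr, eval_sympFormPoly, ne_eq,
      mul_eq_zero, not_or] at hab
    obtain ⟨⟨⟨h1, h2⟩, h3⟩, h4⟩ := hab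
    have hFab : F a b = F e f₀ * sympForm a b ^ k :=
      invariant_eq_sympForm_pow k F hF hl hr hef
        (by rw [sympForm_swap f₀ a, sympForm_single_natAdd_left]; simpa using h1)
        (by rwa [sympForm_single_castAdd_left]) h4
        (by rw [sympForm_single_natAdd_left]; simpa using h3)
    rw [hDapp _ _ (linForm_pow_isHomogeneous a k) (linForm_pow_isHomogeneous b k),
      fullContraction_linForm, hcB]
    change F a b - _ = 0
    rw [hFab]
    field_simp
    ring
  refine ⟨cB, fun f h => ?_⟩
  have := bilin_eq_zero_of_linForm_pow k D Q hQ hgen f h f.2 h.2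
  rw [hDapp _ _ f.2 h.2] at this
  exact sub_eq_zero.mp this
end

section
/- Let K be a field of characteristic zero, n ≥ 1, r ≥ 1, and let J = K[x_1,…,x_{2n}]/(x_1,…,x_{2n})^{r+1} be the truncated polynomial algebra. Call an r-jet symplectomorphism a polynomial map g : K^{2n} → K^{2n} with g(0) = 0 such that all homogeneous components of degree ≤ r−1 of g^*ω_0 − ω_0 vanish, taken modulo terms of degree > r; these form a group under truncated composition acting on J by f ↦ f∘g^{-1} (truncated). Then every bilinear map B : J × J → K satisfying B(f∘g, h∘g) = B(f, h) for all r-jet symplectomorphisms g is of the form B(f,h) = a·f(0)h(0) + b·{f,h}(0) for some constants a, b ∈ K, where {f,h} is the Poisson bracket (which on J depends only on the linear parts of f and h). -/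
open MvPolynomial

/-- Truncation of a polynomial modulo `(x_1,…,x_N)^{r+1}`: the sum of its homogeneous
components of degree `≤ r`.  This realizes the truncated polynomial algebra
`J = K[x]/(x)^{r+1}` inside the polynomial ring. -/
noncomputable def truncP {K : Type} [Field K] {N : ℕ} (r : ℕ)
    (f : MvPolynomial (Fin N) K) : MvPolynomial (Fin N) K :=
  ∑ d ∈ Finset.range (r + 1), homogeneousComponent d f

/-- The Poisson bracket `{f,h} = Σ_i (∂_i f ∂_{n+i} h − ∂_{n+i} f ∂_i h)`. -/
noncomputable def poisBr (K : Type) [Field K] (n : ℕ)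
    (f h : MvPolynomial (Fin (n + n)) K) : MvPolynomial (Fin (n + n)) K :=
  ∑ i : Fin n, (pderiv (Fin.castAdd n i) f * pderiv (Fin.natAdd n i) h
    - pderiv (Fin.natAdd n i) f * pderiv (Fin.castAdd n i) h)

/-- The components of the pullback `g^*ω_0`:
`(g^*ω_0)_{ab} = Σ_{i,j} ω_0(e_i,e_j) ∂_a g_i ∂_b g_j`. -/
noncomputable def pullSymp (K : Type) [Field K] (n : ℕ)
    (g : Fin (n + n) → MvPolynomial (Fin (n + n)) K) (a b : Fin (n + n)) :
    MvPolynomial (Fin (n + n)) K :=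
  ∑ i, ∑ j, C (sympK K n i j) * pderiv a (g i) * pderiv b (g j)

/-- `g` represents an `r`-jet symplectomorphism: `g(0) = 0` and all homogeneous components
of degree `≤ r−1` of `g^*ω_0 − ω_0` vanish (this depends only on the `r`-jet of `g`). -/
def IsSympJet (K : Type) [Field K] (n r : ℕ)
    (g : Fin (n + n) → MvPolynomial (Fin (n + n)) K) : Prop :=
  (∀ i, constantCoeff (g i) = 0) ∧
  (∀ a b : Fin (n + n), ∀ d : ℕ, d ≤ r - 1 →
    homogeneousComponent d (pullSymp K n g a b - C (sympK K n a b)) = 0)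

section Truncation

variable {K : Type} [Field K] {N : ℕ}

theorem coeff_truncP (r : ℕ) (f : MvPolynomial (Fin N) K) (d : Fin N →₀ ℕ) :
    coeff d (truncP r f) = if d.degree ≤ r then coeff d f else 0 := by
  simp [truncP, coeff_sum, coeff_homogeneousComponent]

/-- Truncation as a linear map. -/
noncomputable def truncLM (K : Type) [Field K] (N r : ℕ) :
    MvPolynomial (Fin N) K →ₗ[K] MvPolynomial (Fin N) K :=
  ∑ d ∈ Finset.range (r + 1), homogeneousComponent d

theorem truncLM_apply (r : ℕ) (f : MvPolynomial (Fin N) K) : truncLM K N r f = truncP r f := by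
  simp [truncLM, truncP, LinearMap.sum_apply]

theorem totalDegree_truncP_le (r : ℕ) (f : MvPolynomial (Fin N) K) :
    (truncP r f).totalDegree ≤ r := by
  refine Finset.sup_le fun d hd => ?_
  change d.degree ≤ r
  by_contra h
  simp [coeff_truncP, h] at hd

theorem truncP_eq_self {r : ℕ} {f : MvPolynomial (Fin N) K} (hf : f.totalDegree ≤ r) :
    truncP r f = f := by
  ext d
  rw [coeff_truncP]
  split_ifs with h
  · rfl
  · symm
    by_contra h'
    exact h ((le_totalDegree (mem_support_iff.mpr h')).trans hf)

theorem truncP_eq_truncP_iff {r : ℕ} {f g : MvPolynomial (Fin N) K} :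
    truncP r f = truncP r g ↔ f - g ∈ idealOfVars (Fin N) K ^ (r + 1) := by
  rw [mem_pow_idealOfVars_iff', MvPolynomial.ext_iff]
  refine forall_congr' fun d => ?_
  rw [coeff_truncP, coeff_truncP, coeff_sub, sub_eq_zero, Nat.lt_succ_iff]
  split_ifs with h <;> simp [h]

theorem mem_idealOfVars_of_constantCoeff_eq_zero {f : MvPolynomial (Fin N) K}
    (hf : constantCoeff f = 0) : f ∈ idealOfVars (Fin N) K := by
  rw [← pow_one (idealOfVars (Fin N) K), mem_pow_idealOfVars_iff']
  intro d hd
  obtain rfl : d = 0 := by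
    rw [← Finsupp.degree_eq_zero_iff]; omega
  exact hf

theorem truncP_bind₁_truncP (r : ℕ) {g : Fin N → MvPolynomial (Fin N) K}
    (hg : ∀ i, constantCoeff (g i) = 0) (f : MvPolynomial (Fin N) K) :
    truncP r (bind₁ g (truncP r f)) = truncP r (bind₁ g f) := by
  rw [truncP_eq_truncP_iff, ← map_sub]
  have h : truncP r f - f ∈ idealOfVars (Fin N) K ^ (r + 1) :=
    truncP_eq_truncP_iff.mp (truncP_eq_self (totalDegree_truncP_le r f))
  have hle : (idealOfVars (Fin N) K).map (bind₁ g) ≤ idealOfVars (Fin N) K := by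
    rw [Ideal.map_span, Ideal.span_le]
    rintro _ ⟨_, ⟨i, rfl⟩, rfl⟩
    simpa using mem_idealOfVars_of_constantCoeff_eq_zero (hg i)
  have := Ideal.mem_map_of_mem (bind₁ g) h
  rw [Ideal.map_pow] at this
  exact Ideal.pow_right_mono hle _ this

end Truncation

section Flow

variable {K : Type} [Field K] {σ : Type}

/-- If a bilinear form is constant along a pair of polynomial curves, then its derivative
at `0` vanishes. -/
theorem bilin_coeff_one_eq_zero [CharZero K] {P : Type} [CommRing P] [Algebra K P]
    (A : P →ₗ[K] P →ₗ[K] K)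
    (F G : Polynomial P) (a : K)
    (h : ∀ t : K, A (F.eval (algebraMap K P t)) (G.eval (algebraMap K P t)) = a) :
    A (F.coeff 1) (G.coeff 0) + A (F.coeff 0) (G.coeff 1) = 0 := by
  set M := max F.natDegree G.natDegree with hM
  set Q : Polynomial K := ∑ i ∈ Finset.range (M + 2), ∑ j ∈ Finset.range (M + 2),
    Polynomial.monomial (i + j) (A (F.coeff i) (G.coeff j)) with hQ
  have hQa : Q = Polynomial.C a := by
    refine Polynomial.funext fun t => ?_
    rw [Polynomial.eval_C, ← h t,
      Polynomial.eval_eq_sum_range' (show F.natDegree < M + 2 by omega),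
      Polynomial.eval_eq_sum_range' (show G.natDegree < M + 2 by omega), hQ]
    simp only [Polynomial.eval_finsetSum, Polynomial.eval_monomial, map_sum,
      LinearMap.sum_apply, ← map_pow, mul_comm _ (algebraMap K P _), ← Algebra.smul_def,
      map_smul, LinearMap.smul_apply, smul_eq_mul]
    rw [Finset.sum_comm]
    refine Finset.sum_congr rfl fun i _ => ?_
    rw [Finset.mul_sum]
    refine Finset.sum_congr rfl fun j _ => ?_
    ring
  have h1 : Q.coeff 1 = 0 := by simp [hQa]
  rw [hQ] at h1
  simp only [Polynomial.finsetSum_coeff, Polynomial.coeff_monomial] at h1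
  rw [Finset.sum_range_succ', Finset.sum_range_succ'] at h1
  simp only [Finset.sum_range_succ' _ (M + 1), Finset.sum_range_succ' _ M] at h1
  have hne : ∀ x y : ℕ, x + (2 + (y + 2)) ≠ 1 := by omega
  simpa [add_assoc, hne] using h1

/-- The family of substitutions `x_i ↦ x_i + t p_i`, as a polynomial in `t`. -/
noncomputable def shearCurve (p : σ → MvPolynomial σ K) :
    MvPolynomial σ K →ₐ[K] Polynomial (MvPolynomial σ K) :=
  aeval fun i => Polynomial.C (X i) + Polynomial.X * Polynomial.C (p i)

theorem eval_shearCurve (p : σ → MvPolynomial σ K) (t : K) (f : MvPolynomial σ K) :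
    (shearCurve p f).eval (algebraMap K _ t) = bind₁ (fun i => X i + C t * p i) f := by
  induction f using MvPolynomial.induction_on with
  | C a => simp [shearCurve, Polynomial.algebraMap_apply, algebraMap_eq]
  | add f g hf hg => rw [map_add, map_add, Polynomial.eval_add, hf, hg]
  | mul_X f i hf =>
    rw [map_mul, map_mul, Polynomial.eval_mul, hf]
    simp [shearCurve, algebraMap_eq, mul_comm (p i)]

theorem coeff_zero_shearCurve (p : σ → MvPolynomial σ K) (f : MvPolynomial σ K) :
    (shearCurve p f).coeff 0 = f := by
  induction f using MvPolynomial.induction_on with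
  | C a => simp [shearCurve, Polynomial.algebraMap_apply, algebraMap_eq]
  | add f g hf hg => simp [hf, hg]
  | mul_X f i hf => rw [map_mul, Polynomial.mul_coeff_zero, hf]; simp [shearCurve]

theorem coeff_one_shearCurve (p : σ → MvPolynomial σ K) (f : MvPolynomial σ K) :
    (shearCurve p f).coeff 1 = mkDerivation K p f := by
  induction f using MvPolynomial.induction_on with
  | C a => simp [shearCurve, Polynomial.algebraMap_apply, algebraMap_eq]
  | add f g hf hg => simp [hf, hg]
  | mul_X f i hf =>
    rw [map_mul, Polynomial.mul_coeff_one, hf, coeff_zero_shearCurve, Derivation.leibniz]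
    simp [shearCurve, Polynomial.coeff_C]
    ring

/-- A bilinear form invariant under the substitutions `x_i ↦ x_i + t p_i` is infinitesimally
invariant under the derivation `x_i ↦ p_i`. -/
theorem mkDerivation_invariant [CharZero K]
    (A : MvPolynomial σ K →ₗ[K] MvPolynomial σ K →ₗ[K] K)
    (p : σ → MvPolynomial σ K)
    (h : ∀ (t : K) f g, A (bind₁ (fun i => X i + C t * p i) f)
      (bind₁ (fun i => X i + C t * p i) g) = A f g) (f g : MvPolynomial σ K) :
    A (mkDerivation K p f) g + A f (mkDerivation K p g) = 0 := by
  have := bilin_coeff_one_eq_zero A (shearCurve p f) (shearCurve p g) (A f g)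
    (fun t => by rw [eval_shearCurve, eval_shearCurve, h])
  rwa [coeff_zero_shearCurve, coeff_zero_shearCurve, coeff_one_shearCurve,
    coeff_one_shearCurve] at this

/-- A linear functional killing the `d`-th powers of all linear forms kills all monomials of
degree `d`. -/
theorem linearMap_monomial_eq_zero [CharZero K] [Fintype σ] [DecidableEq σ]
    (φ : MvPolynomial σ K →ₗ[K] K) (d : ℕ) (h : ∀ u : σ → K, φ ((∑ i, C (u i) * X i) ^ d) = 0)
    (s : σ →₀ ℕ) (hs : s.degree = d) : φ (monomial s 1) = 0 := by
  set Q : MvPolynomial σ K := ∑ k ∈ Finset.piAntidiag Finset.univ d,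
    monomial (Finsupp.equivFunOnFinite.symm k)
      ((Nat.multinomial Finset.univ k : K) *
        φ (monomial (Finsupp.equivFunOnFinite.symm k) 1)) with hQ
  have hQ0 : Q = 0 := by
    refine MvPolynomial.funext fun u => ?_
    rw [map_zero, ← h u, Finset.sum_pow_eq_sum_piAntidiag, hQ, map_sum, map_sum]
    refine Finset.sum_congr rfl fun k _ => ?_
    have : (Nat.multinomial Finset.univ k : MvPolynomial σ K) * ∏ i, (C (u i) * X i) ^ k i
        = ((Nat.multinomial Finset.univ k : K) * ∏ i, u i ^ k i) •
          monomial (Finsupp.equivFunOnFinite.symm k) 1 := by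
      rw [monomial_eq, Finsupp.prod_fintype _ _ (by simp), smul_eq_C_mul]
      simp [mul_pow, Finset.prod_mul_distrib, mul_assoc]
    rw [this, map_smul, eval_monomial, Finsupp.prod_fintype _ _ (by simp)]
    simp
    ring
  have hc : coeff s Q = 0 := by simp [hQ0]
  have hmem : (⇑s) ∈ Finset.piAntidiag Finset.univ d := by
    simp [← hs, Finsupp.degree_eq_sum]
  rw [hQ, coeff_sum, Finset.sum_eq_single (⇑s)] at hc
  · have hs' : Finsupp.equivFunOnFinite.symm (⇑s) = s := by ext; simp
    rw [hs', coeff_monomial, if_pos rfl, mul_eq_zero] at hc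
    exact hc.resolve_left (by exact_mod_cast (Nat.multinomial_pos _ _).ne')
  · intro k _ hk
    rw [coeff_monomial, if_neg]
    rintro rfl
    exact hk (by ext; simp)
  · exact fun h' => absurd hmem h'

end Flow

/-- A fixed-point-free involution `c` of the index set together with signs `ε`, encoding the
symplectic form with `ω(e_i, e_{c i}) = ε i`. -/
structure IsSympInvol {K σ : Type} [Field K] (c : σ → σ) (ε : σ → K) : Prop where
  invol : ∀ i, c (c i) = i
  ne : ∀ i, c i ≠ i
  neg : ∀ i, ε (c i) = -ε i
  sq : ∀ i, ε i * ε i = 1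

/-- The Poisson bracket attached to an involution of the index set and signs. -/
noncomputable def involBracket {K σ : Type} [Field K] [Fintype σ] (c : σ → σ) (ε : σ → K)
    (f h : MvPolynomial σ K) : MvPolynomial σ K :=
  ∑ i, C (ε i) * (pderiv i f * pderiv (c i) h)

section Bracket

variable {K σ : Type} [Field K] [Fintype σ] {c : σ → σ} {ε : σ → K}

theorem involBracket_add_left (f g h : MvPolynomial σ K) :
    involBracket c ε (f + g) h = involBracket c ε f h + involBracket c ε g h := by
  simp [involBracket, add_mul, mul_add, Finset.sum_add_distrib]

theorem involBracket_add_right (f g h : MvPolynomial σ K) :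
    involBracket c ε f (g + h) = involBracket c ε f g + involBracket c ε f h := by
  simp [involBracket, mul_add, Finset.sum_add_distrib]

theorem involBracket_smul_left (a : K) (f h : MvPolynomial σ K) :
    involBracket c ε (a • f) h = a • involBracket c ε f h := by
  simp [involBracket, Finset.smul_sum]

theorem involBracket_smul_right (a : K) (f h : MvPolynomial σ K) :
    involBracket c ε f (a • h) = a • involBracket c ε f h := by
  simp [involBracket, Finset.smul_sum]

theorem involBracket_mul_left (f g h : MvPolynomial σ K) :
    involBracket c ε (f * g) h = f * involBracket c ε g h + g * involBracket c ε f h := by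
  simp only [involBracket, Derivation.leibniz, smul_eq_mul, Finset.mul_sum,
    ← Finset.sum_add_distrib]
  exact Finset.sum_congr rfl fun i _ => by ring

theorem involBracket_mul_right (f g h : MvPolynomial σ K) :
    involBracket c ε f (g * h) = g * involBracket c ε f h + h * involBracket c ε f g := by
  simp only [involBracket, Derivation.leibniz, smul_eq_mul, Finset.mul_sum,
    ← Finset.sum_add_distrib]
  exact Finset.sum_congr rfl fun i _ => by ring

theorem involBracket_one_right (f : MvPolynomial σ K) : involBracket c ε f 1 = 0 := by
  simp [involBracket]

theorem involBracket_one_left (f : MvPolynomial σ K) : involBracket c ε 1 f = 0 := by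
  simp [involBracket]

theorem involBracket_X_left [DecidableEq σ] (i : σ) (f : MvPolynomial σ K) :
    involBracket c ε (X i) f = C (ε i) * pderiv (c i) f := by
  rw [involBracket, Finset.sum_eq_single i] <;> simp +contextual [pderiv_X]

theorem involBracket_X_right [DecidableEq σ] (hc : IsSympInvol c ε)
    (f : MvPolynomial σ K) (i : σ) :
    involBracket c ε f (X i) = C (-ε i) * pderiv (c i) f := by
  rw [involBracket, Finset.sum_eq_single (c i)]
  · simp [hc.invol, hc.neg]
  · intro j _ hj
    have : i ≠ c j := fun h => hj (by rw [h, hc.invol])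
    simp [pderiv_X, this.symm]
  · simp

theorem involBracket_X_X [DecidableEq σ] (i j : σ) :
    involBracket c ε (X i) (X j) = if j = c i then C (ε i) else 0 := by
  rw [involBracket_X_left, pderiv_X, Pi.single_apply]
  split_ifs <;> simp

theorem involBracket_eq_mkDerivation (H f : MvPolynomial σ K) :
    involBracket c ε H f = mkDerivation K (fun i => involBracket c ε H (X i)) f := by
  induction f using MvPolynomial.induction_on with
  | C a => rw [← algebraMap_eq]; simp [involBracket]
  | add f g hf hg => rw [involBracket_add_right, map_add, hf, hg]
  | mul_X f i hf => rw [involBracket_mul_right, hf, Derivation.leibniz]; simp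

theorem isHomogeneous_involBracket {f h : MvPolynomial σ K} {p q : ℕ} (hf : f.IsHomogeneous p)
    (hh : h.IsHomogeneous q) : (involBracket c ε f h).IsHomogeneous (p - 1 + (q - 1)) := by
  refine IsHomogeneous.sum _ _ _ fun i _ => ?_
  simpa using (isHomogeneous_C σ (ε i)).mul (hf.pderiv.mul hh.pderiv)

theorem exists_pderiv_eq {K σ : Type} [Field K] [CharZero K] (i : σ) (G : MvPolynomial σ K) :
    ∃ F, pderiv i F = G := by
  induction G using MvPolynomial.induction_on' with
  | monomial s a =>
    refine ⟨monomial (s + Finsupp.single i 1) (a / (s i + 1 : K)), ?_⟩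
    rw [pderiv_monomial]
    have : (s i + 1 : K) ≠ 0 := by exact_mod_cast Nat.succ_ne_zero (s i)
    simp [this]
  | add p q hp hq =>
    obtain ⟨F, rfl⟩ := hp
    obtain ⟨F', rfl⟩ := hq
    exact ⟨F + F', map_add _ _ _⟩

end Bracket

section Invariant

variable {K σ : Type} [Field K] [Fintype σ] {c : σ → σ} {ε : σ → K}

/-- Infinitesimal invariance under all Hamiltonian vector fields with Hamiltonians without
terms of degree `≤ 1`. -/
def HamInvariant {K σ : Type} [Field K] [Fintype σ] (c : σ → σ) (ε : σ → K)
    (A : MvPolynomial σ K →ₗ[K] MvPolynomial σ K →ₗ[K] K) : Prop :=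
  ∀ s : σ →₀ ℕ, 2 ≤ s.degree → ∀ f h,
    A (involBracket c ε (monomial s 1) f) h + A f (involBracket c ε (monomial s 1) h) = 0

variable {A : MvPolynomial σ K →ₗ[K] MvPolynomial σ K →ₗ[K] K}

theorem HamInvariant.flip (hA : HamInvariant c ε A) : HamInvariant c ε A.flip := by
  intro s hs f h
  simpa [add_comm] using hA s hs h f

theorem HamInvariant.X_mul_X (hA : HamInvariant c ε A) (i j : σ) (f h : MvPolynomial σ K) :
    A (involBracket c ε (X i * X j) f) h + A f (involBracket c ε (X i * X j) h) = 0 := by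
  have h2 : (X i * X j : MvPolynomial σ K)
      = monomial (Finsupp.single i 1 + Finsupp.single j 1) 1 := by
    simp [X, monomial_mul]
  rw [h2]
  exact hA _ (by simp) f h

theorem HamInvariant.X_X_mul_self [CharZero K] [DecidableEq σ]
    (hc : IsSympInvol c ε) (hA : HamInvariant c ε A) (i : σ)
    (G : MvPolynomial σ K) : A (X i) (X i * G) = 0 := by
  obtain ⟨F, rfl⟩ := exists_pderiv_eq (c i) G
  have h := hA.X_mul_X i i (X i) F
  rw [involBracket_mul_left, involBracket_mul_left, involBracket_X_X, if_neg (hc.ne i).symm,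
    involBracket_X_left] at h
  have h3 : X i * (C (ε i) * pderiv (c i) F) + X i * (C (ε i) * pderiv (c i) F)
      = (2 * ε i) • (X i * pderiv (c i) F) := by
    rw [smul_eq_C_mul, C_mul, show (C 2 : MvPolynomial σ K) = 2 from rfl]; ring
  have hε : ε i ≠ 0 := fun h0 => by simpa [h0] using hc.sq i
  rw [h3] at h
  simpa [hε] using h

theorem HamInvariant.X_X_mul [CharZero K] [DecidableEq σ]
    (hc : IsSympInvol c ε) (hA : HamInvariant c ε A) {i k : σ}
    (hk : k ≠ c i) (G : MvPolynomial σ K) : A (X i) (X k * G) = 0 := by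
  obtain ⟨F, rfl⟩ := exists_pderiv_eq (c i) G
  have h := hA.X_mul_X i k (X i) F
  have hki : i ≠ c k := fun h => hk (by rw [h, hc.invol])
  have hε : ε i ≠ 0 := fun h0 => by simpa [h0] using hc.sq i
  rw [involBracket_mul_left, involBracket_mul_left, involBracket_X_X, involBracket_X_X, if_neg hki,
    if_neg (hc.ne i).symm, mul_zero, mul_zero, add_zero, map_zero, LinearMap.zero_apply, zero_add,
    map_add, hA.X_X_mul_self hc, involBracket_X_left,
    mul_left_comm, ← smul_eq_C_mul] at h
  simpa [hε] using h

theorem involBracket_X_X_pow [DecidableEq σ] (i : σ) (k : ℕ) :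
    involBracket c ε (X i) (X (c i) ^ k : MvPolynomial σ K)
      = C (ε i * k) * X (c i) ^ (k - 1) := by
  rw [involBracket_X_left, Derivation.leibniz_pow, pderiv_X_self, map_mul]
  simp [mul_assoc]

theorem HamInvariant.X_conj_pow [CharZero K] [DecidableEq σ]
    (hc : IsSympInvol c ε) (hA : HamInvariant c ε A) (i : σ) {k : ℕ}
    (hk : 2 ≤ k) : A (X i) (X (c i) ^ k) = 0 := by
  have h := hA.X_mul_X i (c i) (X i) (X (c i) ^ k)
  have hε : ε i ≠ 0 := fun h0 => by simpa [h0] using hc.sq i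
  have h0 : involBracket c ε (X (c i)) (X (c i) ^ k : MvPolynomial σ K) = 0 := by
    rw [involBracket_X_left, Derivation.leibniz_pow, pderiv_X_of_ne (hc.ne (c i)).symm]
    simp
  have hpow : X (c i) * (C (ε i * k) * X (c i) ^ (k - 1))
      = (ε i * k) • (X (c i) ^ k : MvPolynomial σ K) := by
    obtain ⟨m, rfl⟩ : ∃ m, k = m + 1 := ⟨k - 1, by omega⟩
    rw [smul_eq_C_mul, Nat.add_sub_cancel]; ring
  rw [involBracket_mul_left, involBracket_mul_left, involBracket_X_X, involBracket_X_X, h0,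
    if_neg (hc.ne i).symm, if_pos (hc.invol i).symm, involBracket_X_X_pow, hpow, hc.neg,
    mul_zero, add_zero, mul_zero, zero_add, mul_comm, ← smul_eq_C_mul, map_smul, map_smul,
    LinearMap.smul_apply, smul_eq_mul, smul_eq_mul] at h
  have h4 : ε i * ((k : K) - 1) * A (X i) (X (c i) ^ k) = 0 := by linear_combination h
  have hk1 : (k : K) - 1 ≠ 0 := by
    rw [sub_ne_zero]; exact_mod_cast (show k ≠ 1 by omega)
  simpa [hε, hk1] using h4

theorem HamInvariant.X_monomial [CharZero K] [DecidableEq σ]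
    (hc : IsSympInvol c ε) (hA : HamInvariant c ε A) (i : σ)
    (s : σ →₀ ℕ) (hs : 2 ≤ s.degree) : A (X i) (monomial s 1) = 0 := by
  by_cases h : ∃ k, k ≠ c i ∧ s k ≠ 0
  · obtain ⟨k, hk, hsk⟩ := h
    have hle : Finsupp.single k 1 ≤ s := by simpa [Nat.one_le_iff_ne_zero] using hsk
    have : (monomial s 1 : MvPolynomial σ K) = X k * monomial (s - Finsupp.single k 1) 1 := by
      rw [X, monomial_mul, add_tsub_cancel_of_le hle, one_mul]
    rw [this, hA.X_X_mul hc hk]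
  · push Not at h
    have hs' : s = Finsupp.single (c i) (s (c i)) := by
      ext k
      by_cases hk : k = c i
      · simp [hk]
      · simp [h k hk, Ne.symm hk]
    rw [hs', Finsupp.degree_single] at hs
    rw [hs', ← X_pow_eq_monomial, hA.X_conj_pow hc i hs]

theorem HamInvariant.X_homogeneous [CharZero K] [DecidableEq σ]
    (hc : IsSympInvol c ε) (hA : HamInvariant c ε A) (i : σ)
    {f : MvPolynomial σ K} {d : ℕ} (hf : f.IsHomogeneous d) (hd : 2 ≤ d) : A (X i) f = 0 := by
  rw [f.as_sum, map_sum]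
  refine Finset.sum_eq_zero fun s hs => ?_
  have hsd : s.degree = d := by
    rw [← hf (mem_support_iff.mp hs), Finsupp.degree_eq_weight_one]; rfl
  rw [show monomial s (coeff s f) = coeff s f • monomial s 1 by simp [smul_monomial], map_smul,
    hA.X_monomial hc i s (by omega), smul_zero]

/-- Every nonconstant monomial is a bracket of a monomial of higher degree with a variable. -/
theorem involBracket_monomial_X [DecidableEq σ] (hc : IsSympInvol c ε) (i : σ) (s : σ →₀ ℕ) :
    involBracket c ε (monomial (s + Finsupp.single (c i) 1) 1) (X i)
      = (-ε i * (s (c i) + 1)) • monomial s 1 := by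
  rw [involBracket_X_right hc, pderiv_monomial, C_mul_monomial, smul_monomial]
  simp

theorem HamInvariant.monomial_left [CharZero K] [DecidableEq σ]
    (hc : IsSympInvol c ε) (hA : HamInvariant c ε A) (i : σ)
    (s : σ →₀ ℕ) (hs : 1 ≤ s.degree) (h : MvPolynomial σ K)
    (hz : A (X i) (involBracket c ε (monomial (s + Finsupp.single (c i) 1) 1) h) = 0) :
    A (monomial s 1) h = 0 := by
  have hε : ε i ≠ 0 := fun h0 => by simpa [h0] using hc.sq i
  have hi := hA (s + Finsupp.single (c i) 1) (by
    rw [map_add, Finsupp.degree_single]; omega) (X i) h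
  have hs1 : (s (c i) : K) + 1 ≠ 0 := by exact_mod_cast Nat.succ_ne_zero (s (c i))
  rw [hz, add_zero, involBracket_monomial_X hc] at hi
  simpa [hε, hs1] using hi

theorem HamInvariant.monomial_one [CharZero K] [DecidableEq σ]
    (hc : IsSympInvol c ε) (hA : HamInvariant c ε A) [Nonempty σ]
    (s : σ →₀ ℕ) (hs : 1 ≤ s.degree) : A (monomial s 1) 1 = 0 :=
  hA.monomial_left hc (Classical.arbitrary σ) s hs 1 (by simp [involBracket_one_right])

theorem HamInvariant.monomial_monomial [CharZero K] [DecidableEq σ]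
    (hc : IsSympInvol c ε) (hA : HamInvariant c ε A)
    [Nonempty σ] (s t : σ →₀ ℕ) (hs : 1 ≤ s.degree) (ht : 1 ≤ t.degree)
    (hst : 3 ≤ s.degree + t.degree) : A (monomial s 1) (monomial t 1) = 0 := by
  refine hA.monomial_left hc (Classical.arbitrary σ) s hs _ ?_
  refine hA.X_homogeneous hc _ (isHomogeneous_involBracket (isHomogeneous_monomial _ rfl)
    (isHomogeneous_monomial _ rfl)) ?_
  simp
  omega

theorem HamInvariant.X_X [CharZero K] [DecidableEq σ]
    (hc : IsSympInvol c ε) (hA : HamInvariant c ε A) {i k : σ}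
    (hk : k ≠ c i) : A (X i) (X k) = 0 := by
  simpa using hA.X_X_mul hc hk 1

theorem HamInvariant.X_conj_eq [CharZero K] [DecidableEq σ]
    (hc : IsSympInvol c ε) (hA : HamInvariant c ε A) (i j : σ) :
    ε i * A (X i) (X (c i)) = ε j * A (X j) (X (c j)) := by
  obtain ⟨j, rfl⟩ : ∃ j', j = c j' := ⟨c j, (hc.invol j).symm⟩
  have h := hA.X_mul_X (c i) (c j) (X i) (X j)
  have hii : involBracket c ε (X (c i)) (X i : MvPolynomial σ K) = C (-ε i) := by
    rw [involBracket_X_X, if_pos (hc.invol i).symm, hc.neg]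
  have hjj : involBracket c ε (X (c j)) (X j : MvPolynomial σ K) = C (-ε j) := by
    rw [involBracket_X_X, if_pos (hc.invol j).symm, hc.neg]
  have hC : ∀ (p : MvPolynomial σ K) (a : K), p * C a = a • p := fun p a => by
    rw [smul_eq_C_mul, mul_comm]
  have e1 := hc.sq i
  have e2 := hc.sq j
  rw [hc.invol, hc.neg]
  by_cases hij : i = j
  · subst hij
    rw [involBracket_mul_left, hii, hC] at h
    simp only [map_add, map_smul, LinearMap.add_apply, LinearMap.smul_apply, smul_eq_mul] at h
    have h2 : (2 : K) * (ε i * A (X i) (X (c i)) + ε i * A (X (c i)) (X i)) = 0 := by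
      linear_combination -h
    have := (mul_eq_zero.mp h2).resolve_left two_ne_zero
    linear_combination this
  · have hij' : involBracket c ε (X (c i)) (X j : MvPolynomial σ K) = 0 := by
      rw [involBracket_X_X, if_neg (by rw [hc.invol]; exact Ne.symm hij)]
    have hji' : involBracket c ε (X (c j)) (X i : MvPolynomial σ K) = 0 := by
      rw [involBracket_X_X, if_neg (by rw [hc.invol]; exact hij)]
    rw [involBracket_mul_left, involBracket_mul_left, hii, hjj, hij', hji', hC, hC] at h
    simp only [mul_zero, zero_add, add_zero, map_smul, LinearMap.smul_apply, smul_eq_mul] at h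
    linear_combination (-ε i * ε j) * h + (-ε j * A (X (c j)) (X j)) * e1
      + (-ε i * A (X i) (X (c i))) * e2

end Invariant

section Standard

variable {K : Type} [Field K] {n : ℕ}

/-- The signs of the standard symplectic form. -/
def sympSign (K : Type) [Field K] (n : ℕ) (i : Fin (n + n)) : K :=
  if (i : ℕ) < n then 1 else -1

theorem isSympInvol_finAddFlip : IsSympInvol (finAddFlip : Fin (n + n) ≃ _) (sympSign K n) where
  invol i := by refine Fin.addCases (fun k => ?_) (fun k => ?_) i <;> simp [-Fin.natAdd_eq_addNat]
  ne i := by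
    refine Fin.addCases (fun k => ?_) (fun k => ?_) i
    · rw [finAddFlip_apply_castAdd, Ne, Fin.ext_iff, Fin.val_natAdd, Fin.val_castAdd]; omega
    · rw [finAddFlip_apply_natAdd, Ne, Fin.ext_iff, Fin.val_natAdd, Fin.val_castAdd]; omega
  neg i := by refine Fin.addCases (fun k => ?_) (fun k => ?_) i <;>
      simp [-Fin.natAdd_eq_addNat, sympSign]
  sq i := by refine Fin.addCases (fun k => ?_) (fun k => ?_) i <;> simp [sympSign]

theorem sympK_eq (i j : Fin (n + n)) :
    sympK K n i j = if j = finAddFlip i then sympSign K n i else 0 := by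
  refine Fin.addCases (fun k => ?_) (fun k => ?_) i <;>
    refine Fin.addCases (fun l => ?_) (fun l => ?_) j <;>
    simp [-Fin.natAdd_eq_addNat, sympK, sympSign, Fin.ext_iff, eq_comm] <;> grind

theorem poisBr_eq (f h : MvPolynomial (Fin (n + n)) K) :
    poisBr K n f h = involBracket (finAddFlip : Fin (n + n) ≃ _) (sympSign K n) f h := by
  rw [poisBr, involBracket, Fin.sum_univ_add, ← Finset.sum_add_distrib]
  refine Finset.sum_congr rfl fun i _ => ?_
  simp [-Fin.natAdd_eq_addNat, sympSign, sub_eq_add_neg]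

theorem pullSymp_eq (g : Fin (n + n) → MvPolynomial (Fin (n + n)) K) (a b : Fin (n + n)) :
    pullSymp K n g a b =
      ∑ i, C (sympSign K n i) * pderiv a (g i) * pderiv b (g (finAddFlip i)) := by
  refine Finset.sum_congr rfl fun i _ => ?_
  rw [Finset.sum_eq_single (finAddFlip i)]
  · rw [sympK_eq, if_pos rfl]
  · intro j _ hj
    simp [sympK_eq, hj]
  · simp

theorem pderiv_linearForm {σ : Type} [Fintype σ] [DecidableEq σ] (u : σ → K) (i : σ) :
    pderiv i (∑ j, C (u j) * X j) = C (u i) := by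
  simp [pderiv_X, Pi.single_apply]

/-- The form `Σ ε_i w_i w_{c i}` vanishes, by antisymmetry. -/
theorem IsSympInvol.sum_eq_zero {σ : Type} [CharZero K] [Fintype σ] {c : σ → σ} {ε : σ → K}
    (hc : IsSympInvol c ε) (w : σ → K) : ∑ i, ε i * w i * w (c i) = 0 := by
  have h : ∑ i, ε i * w i * w (c i) = ∑ i, ε (c i) * w (c i) * w (c (c i)) :=
    (Equiv.sum_comp ⟨c, c, hc.invol, hc.invol⟩ fun i => ε i * w i * w (c i)).symm
  have h' : ∑ i, ε (c i) * w (c i) * w (c (c i)) = -∑ i, ε i * w i * w (c i) := by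
    rw [← Finset.sum_neg_distrib]
    refine Finset.sum_congr rfl fun i _ => ?_
    rw [hc.invol, hc.neg]; ring
  rw [h'] at h
  exact self_eq_neg.mp h

/-- The time-`t` flow of the Hamiltonian `ℓ ^ d`, for a linear form `ℓ`, preserves the symplectic
form. -/
theorem isSympJet_shear [CharZero K] (r : ℕ) {d : ℕ} (hd : 2 ≤ d) (u : Fin (n + n) → K) (t : K) :
    IsSympJet K n r fun i => X i + C t *
      involBracket (finAddFlip : Fin (n + n) ≃ _) (sympSign K n)
        ((∑ j, C (u j) * X j) ^ d) (X i) := by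
  have hc : IsSympInvol (finAddFlip : Fin (n + n) ≃ _) (sympSign K n) := isSympInvol_finAddFlip
  set c : Fin (n + n) → Fin (n + n) := ⇑(finAddFlip : Fin (n + n) ≃ _) with hcdef
  set ε := sympSign K n
  set l : MvPolynomial (Fin (n + n)) K := ∑ j, C (u j) * X j with hl
  have hp : ∀ i, involBracket c ε (l ^ d) (X i) = C (-ε i * u (c i)) *
      ((d : MvPolynomial (Fin (n + n)) K) * l ^ (d - 1)) := by
    intro i
    rw [involBracket_X_right hc, Derivation.leibniz_pow, pderiv_linearForm]
    simp only [nsmul_eq_mul, smul_eq_mul, map_mul]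
    ring
  refine ⟨fun i => ?_, fun a b e _ => ?_⟩
  · have : d - 1 ≠ 0 := by omega
    simp only [hp]
    simp [hl, this]
  · have hg : ∀ a i, pderiv a (X i + C t * involBracket c ε (l ^ d) (X i))
        = (if i = a then 1 else 0) + C (-ε i * u (c i)) * (C (u a) *
          (C t * ((d : MvPolynomial (Fin (n + n)) K) *
            (((d - 1 : ℕ) : MvPolynomial (Fin (n + n)) K) * l ^ (d - 1 - 1))))) := by
      intro a i
      rw [hp, map_add, pderiv_X, Pi.single_apply, pderiv_C_mul, pderiv_C_mul,
        Derivation.leibniz, Derivation.leibniz_pow, pderiv_linearForm]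
      simp only [nsmul_eq_mul, smul_eq_mul, Derivation.map_natCast]
      ring
    generalize C t * ((d : MvPolynomial (Fin (n + n)) K) *
            (((d - 1 : ℕ) : MvPolynomial (Fin (n + n)) K) * l ^ (d - 1 - 1))) = Q
      at hg
    suffices h : pullSymp K n (fun i => X i + C t * involBracket c ε (l ^ d) (X i)) a b
        = C (sympK K n a b) by rw [h, sub_self, map_zero]
    rw [pullSymp_eq]
    simp only [hg]
    have hterm : ∀ i, C (ε i) * ((if i = a then 1 else 0) + C (-ε i * u (c i)) * (C (u a) * Q)) *
        ((if c i = b then 1 else 0) + C (-ε (c i) * u (c (c i))) * (C (u b) * Q))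
        = (if i = a then (if c i = b then C (ε i) else 0) + C (u i) * C (u b) * Q else 0)
          - (if i = c b then C (u (c i)) * C (u a) * Q else 0)
          - C (ε i * u i * u (c i)) * (C (u a) * C (u b) * Q ^ 2) := by
      intro i
      have e1 : C (ε i) * C (ε i) = (1 : MvPolynomial (Fin (n + n)) K) := by
        rw [← C_mul, hc.sq, C_1]
      have hib : i = c b ↔ c i = b :=
        ⟨fun h => by rw [h, hc.invol], fun h => by rw [← h, hc.invol]⟩
      simp only [hib, hc.invol, hc.neg, neg_neg, map_mul, map_neg]
      split_ifs
      · linear_combination (C (u i) * C (u b) * Q - C (u (c i)) * C (u a) * Q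
          - C (ε i) * C (u (c i)) * C (u a) * Q * C (u i) * C (u b) * Q) * e1
      · linear_combination (C (u i) * C (u b) * Q
          - C (ε i) * C (u (c i)) * C (u a) * Q * C (u i) * C (u b) * Q) * e1
      · linear_combination (- C (u (c i)) * C (u a) * Q
          - C (ε i) * C (u (c i)) * C (u a) * Q * C (u i) * C (u b) * Q) * e1
      · linear_combination (
          - C (ε i) * C (u (c i)) * C (u a) * Q * C (u i) * C (u b) * Q) * e1
    rw [Finset.sum_congr rfl fun i _ => hterm i, Finset.sum_sub_distrib, Finset.sum_sub_distrib,
      ← Finset.sum_mul, ← map_sum, hc.sum_eq_zero, Finset.sum_ite_eq' Finset.univ a,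
      Finset.sum_ite_eq' Finset.univ (c b), sympK_eq, ← hcdef]
    simp only [Finset.mem_univ, if_true, hc.invol, map_zero, eq_comm (a := b)]
    split_ifs
    · ring
    · rw [map_zero]; ring

end Standard

/-- Invariance under the flows of powers of linear forms implies invariance under all
Hamiltonian vector fields of order at least two. -/
theorem hamInvariant_of_shears {K σ : Type} [Field K] [CharZero K] [Fintype σ]
    {c : σ → σ} {ε : σ → K}
    (A : MvPolynomial σ K →ₗ[K] MvPolynomial σ K →ₗ[K] K)
    (h : ∀ d, 2 ≤ d → ∀ (u : σ → K) (t : K) f g,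
      A (bind₁ (fun i => X i + C t * involBracket c ε ((∑ j, C (u j) * X j) ^ d) (X i)) f)
        (bind₁ (fun i => X i + C t * involBracket c ε ((∑ j, C (u j) * X j) ^ d) (X i)) g)
          = A f g) : HamInvariant c ε A := by
  classical
  intro s hs f g
  let φ : MvPolynomial σ K →ₗ[K] K :=
    { toFun := fun H => A (involBracket c ε H f) g + A f (involBracket c ε H g)
      map_add' := fun H H' => by
        simp only [involBracket_add_left, map_add, LinearMap.add_apply]; ring
      map_smul' := fun a H => by
        simp only [involBracket_smul_left, map_smul, LinearMap.smul_apply, RingHom.id_apply,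
          smul_add] }
  refine linearMap_monomial_eq_zero φ s.degree (fun u => ?_) s rfl
  change A (involBracket c ε _ f) g + A f (involBracket c ε _ g) = 0
  rw [involBracket_eq_mkDerivation _ f, involBracket_eq_mkDerivation _ g]
  exact mkDerivation_invariant A _ (h _ hs u) f g

theorem HamInvariant.eq_smul_monomial {K σ : Type} [Field K] [CharZero K] [Fintype σ]
    [DecidableEq σ] {c : σ → σ} {ε : σ → K} (hc : IsSympInvol c ε)
    {A : MvPolynomial σ K →ₗ[K] MvPolynomial σ K →ₗ[K] K} (hA : HamInvariant c ε A) (i : σ)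
    (s t : σ →₀ ℕ) : A (monomial s 1) (monomial t 1)
      = A 1 1 * (constantCoeff (monomial s (1 : K)) * constantCoeff (monomial t (1 : K)))
        + ε i * A (X i) (X (c i)) *
          constantCoeff (involBracket c ε (monomial s 1) (monomial t 1)) := by
  have : Nonempty σ := ⟨i⟩
  have hone : (monomial 0 1 : MvPolynomial σ K) = 1 := rfl
  have hcc : ∀ s : σ →₀ ℕ, 1 ≤ s.degree → constantCoeff (monomial s (1 : K)) = 0 := by
    rintro s hs
    have : s ≠ 0 := by rintro rfl; simp at hs
    simp [constantCoeff_monomial, this]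
  rcases Nat.eq_zero_or_pos s.degree with hs | hs
  · rw [Finsupp.degree_eq_zero_iff] at hs
    subst hs
    rw [hone, involBracket_one_left, map_zero, mul_zero, add_zero, map_one constantCoeff, one_mul]
    rcases Nat.eq_zero_or_pos t.degree with ht | ht
    · rw [Finsupp.degree_eq_zero_iff] at ht
      subst ht
      simp [hone]
    · rw [hcc t ht, mul_zero]
      exact hA.flip.monomial_one hc t ht
  rcases Nat.eq_zero_or_pos t.degree with ht | ht
  · rw [Finsupp.degree_eq_zero_iff] at ht
    subst ht
    rw [hone, involBracket_one_right, hA.monomial_one hc s hs, hcc s hs]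
    simp
  rw [hcc s hs, zero_mul, mul_zero, zero_add]
  by_cases hst : 3 ≤ s.degree + t.degree
  · rw [hA.monomial_monomial hc s t hs ht hst]
    have hh : (involBracket c ε (monomial s (1 : K)) (monomial t 1)).IsHomogeneous _ :=
      isHomogeneous_involBracket (isHomogeneous_monomial _ rfl) (isHomogeneous_monomial _ rfl)
    have : constantCoeff (involBracket c ε (monomial s (1 : K)) (monomial t 1)) = 0 :=
      hh.coeff_eq_zero (by rw [map_zero]; omega)
    rw [this, mul_zero]
  · obtain ⟨j, rfl⟩ := (Finsupp.range_single_one (σ := σ)).ge (show s.degree = 1 by omega)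
    obtain ⟨k, rfl⟩ := (Finsupp.range_single_one (σ := σ)).ge (show t.degree = 1 by omega)
    change A (X j) (X k) = _ * constantCoeff (involBracket c ε (X j) (X k))
    rw [involBracket_X_X]
    split_ifs with h
    · subst h
      rw [constantCoeff_C, hA.X_conj_eq hc i j]
      linear_combination (-A (X j) (X (c j))) * hc.sq j
    · rw [hA.X_X hc h]; simp

/-- Classification of the infinitesimally invariant bilinear forms on the polynomial algebra. -/
theorem HamInvariant.eq_smul {K σ : Type} [Field K] [CharZero K] [Fintype σ]
    [DecidableEq σ] {c : σ → σ} {ε : σ → K} (hc : IsSympInvol c ε)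
    {A : MvPolynomial σ K →ₗ[K] MvPolynomial σ K →ₗ[K] K} (hA : HamInvariant c ε A) (i : σ)
    (f h : MvPolynomial σ K) : A f h
      = A 1 1 * (constantCoeff f * constantCoeff h)
        + ε i * A (X i) (X (c i)) * constantCoeff (involBracket c ε f h) := by
  have hmon : ∀ (s : σ →₀ ℕ) (a : K), monomial s a = a • monomial s 1 := by
    simp [smul_monomial]
  induction f using MvPolynomial.induction_on' with
  | add f g hf hg =>
    rw [map_add, LinearMap.add_apply, hf, hg, involBracket_add_left, map_add, map_add]; ring
  | monomial s a =>
    induction h using MvPolynomial.induction_on' with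
    | add f g hf hg => rw [map_add, hf, hg, involBracket_add_right, map_add, map_add]; ring
    | monomial t b =>
      rw [hmon s a, hmon t b, LinearMap.map_smul₂, map_smul, hA.eq_smul_monomial hc i,
        involBracket_smul_left, involBracket_smul_right]
      simp only [constantCoeff_smul, smul_eq_mul]
      ring

/-- Every bilinear map `B : J × J → K` on the truncated polynomial algebra
`J = K[x_1,…,x_{2n}]/(x)^{r+1}` which is invariant under all `r`-jet symplectomorphisms
(`B(f∘g, h∘g) = B(f,h)`) is of the form `B(f,h) = a·f(0)h(0) + b·{f,h}(0)`. -/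
theorem jet_invariant_bilinear_form (K : Type) [Field K] [CharZero K]
    (n r : ℕ) (hn : 1 ≤ n) (hr : 1 ≤ r)
    (B : MvPolynomial (Fin (n + n)) K →ₗ[K] MvPolynomial (Fin (n + n)) K →ₗ[K] K)
    (hinv : ∀ g : Fin (n + n) → MvPolynomial (Fin (n + n)) K, IsSympJet K n r g →
      ∀ f h : MvPolynomial (Fin (n + n)) K, f.totalDegree ≤ r → h.totalDegree ≤ r →
        B (truncP r (bind₁ g f)) (truncP r (bind₁ g h)) = B f h) :
    ∃ a b : K, ∀ f h : MvPolynomial (Fin (n + n)) K,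
      f.totalDegree ≤ r → h.totalDegree ≤ r →
      B f h = a * (constantCoeff f * constantCoeff h)
        + b * constantCoeff (poisBr K n f h) := by
  set A : MvPolynomial (Fin (n + n)) K →ₗ[K] MvPolynomial (Fin (n + n)) K →ₗ[K] K :=
    B.compl₁₂ (truncLM K (n + n) r) (truncLM K (n + n) r) with hAdef
  have hAapp : ∀ f h, A f h = B (truncP r f) (truncP r h) := fun f h => by
    rw [hAdef, LinearMap.compl₁₂_apply, truncLM_apply, truncLM_apply]
  have hA : HamInvariant (finAddFlip : Fin (n + n) ≃ _) (sympSign K n) A := by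
    refine hamInvariant_of_shears A fun d hd u t f h => ?_
    have hg := isSympJet_shear r hd u t
    rw [hAapp, hAapp, ← truncP_bind₁_truncP r hg.1 f, ← truncP_bind₁_truncP r hg.1 h]
    exact hinv _ hg _ _ (totalDegree_truncP_le r f) (totalDegree_truncP_le r h)
  let i : Fin (n + n) := ⟨0, by omega⟩
  refine ⟨A 1 1, sympSign K n i * A (X i) (X (finAddFlip i)), fun f h hf hh => ?_⟩
  have := hA.eq_smul isSympInvol_finAddFlip i f h
  rwa [hAapp f h, truncP_eq_self hf, truncP_eq_self hh, ← poisBr_eq] at this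
end

section
/- Let K be a field of characteristic zero, n ≥ 1, and let V = T^p_q and W = T^{p'}_{q'} be tensor spaces over K^n. Set J^k V = ⊕_{l=0}^k Sym^l(K^n)^* ⊗ V with the componentwise GL(n,K)-action. Let δ : J^k V → W be a GL(n,K)-equivariant polynomial map, homogeneous of degree d, which does not factor through the projection J^k V → J^{k−1}V (i.e. δ depends nontrivially on the top component Sym^k(K^n)^* ⊗ V). Then k ≤ (q' − p') + d(p − q). In particular, the differential order of a natural algebraic operation between tensor bundles is bounded linearly in its degree. -/
open MvPolynomial

/-- Index type for coordinates of the tensor space `T^p_q`. -/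
abbrev TIdx (n p q : ℕ) := (Fin p → Fin n) × (Fin q → Fin n)

/-- Type-`(p,q)` tensor fields on `K^n` with polynomial coefficients: via
`J^k V = ⊕_{l≤k} Sym^l(K^n)^* ⊗ V`, jets are identified with such fields with
coefficients of total degree `≤ k`. -/
abbrev TField (K : Type) [Field K] (n p q : ℕ) := TIdx n p q → MvPolynomial (Fin n) K

/-- Constant type-`(p,q)` tensors. -/
abbrev TConst (K : Type) [Field K] (n p q : ℕ) := TIdx n p q → K

/-- The `GL_n` transformation weight on `T^p_q` (`Ai` stands for `A⁻¹`). -/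
def wtK {K : Type} [Field K] {n p q : ℕ} (A Ai : Matrix (Fin n) (Fin n) K)
    (IJ IJ' : TIdx n p q) : K :=
  (∏ s, A (IJ.1 s) (IJ'.1 s)) * ∏ t, Ai (IJ'.2 t) (IJ.2 t)

/-- The `GL_n`-action on constant tensors. -/
noncomputable def kAct {K : Type} [Field K] {n p q : ℕ}
    (A Ai : Matrix (Fin n) (Fin n) K) (w : TConst K n p q) : TConst K n p q :=
  fun IJ => ∑ IJ' : TIdx n p q, wtK A Ai IJ IJ' * w IJ'

/-- The componentwise `GL_n`-action on `J^k V` realized on polynomial tensor fields. -/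
noncomputable def tAct {K : Type} [Field K] {n p q : ℕ}
    (A Ai : Matrix (Fin n) (Fin n) K) (v : TField K n p q) : TField K n p q :=
  fun IJ => ∑ IJ' : TIdx n p q, wtK A Ai IJ IJ' • polyComp Ai (v IJ')

/-- The coordinates of `J^k V`, `V = T^p_q`: a tensor index together with a monomial
(exponent vector) of degree `≤ k`. -/
abbrev CIdx (n p q k : ℕ) := TIdx n p q × {m : Fin n →₀ ℕ // (m.sum fun _ e => e) ≤ k}

/-- A polynomial map `J^k V → W` given by its coordinate polynomials `F`. -/
noncomputable def evalPoly {K : Type} [Field K] {n p q k p' q' : ℕ}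
    (F : TIdx n p' q' → MvPolynomial (CIdx n p q k) K) (v : TField K n p q) :
    TConst K n p' q' :=
  fun κ => eval (fun s : CIdx n p q k => (v s.1).coeff s.2.1) (F κ)

theorem coeff_bind₁_C_mul_X {K σ : Type*} [Field K] (c : σ → K) (f : MvPolynomial σ K)
    (e : σ →₀ ℕ) :
    (bind₁ (fun i => C (c i) * X i) f).coeff e = (e.prod fun i j => c i ^ j) * f.coeff e := by
  classical
  induction f using MvPolynomial.induction_on' with
  | monomial u a =>
    have h : bind₁ (fun i => C (c i) * X i) (monomial u a)
        = monomial u ((u.prod fun i j => c i ^ j) * a) := by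
      rw [bind₁_monomial]
      simp only [mul_pow, Finset.prod_mul_distrib, ← C_pow, ← map_prod]
      rw [← mul_assoc, ← C_mul, mul_comm a, monomial_eq (s := u)]
      rfl
    rw [h, coeff_monomial, coeff_monomial]
    split_ifs with hu
    · rw [hu]
    · rw [mul_zero]
  | add p q hp hq => rw [map_add, coeff_add, coeff_add, hp, hq, mul_add]

theorem coeff_polyComp_smul_one {K : Type} [Field K] {N : ℕ} (c : K)
    (f : MvPolynomial (Fin N) K) (m : Fin N →₀ ℕ) :
    (polyComp (c • (1 : Matrix (Fin N) (Fin N) K)) f).coeff m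
      = c ^ (m.sum fun _ e => e) * f.coeff m := by
  have h : (fun i : Fin N => ∑ j, C ((c • (1 : Matrix (Fin N) (Fin N) K)) i j) * X j)
      = fun i => (C c * X i : MvPolynomial (Fin N) K) := by
    funext i
    rw [Finset.sum_eq_single i]
    · simp
    · intro j _ hj
      simp [Matrix.one_apply_ne hj.symm]
    · simp
  rw [polyComp, h, coeff_bind₁_C_mul_X (fun _ => c), Finsupp.prod, Finset.prod_pow_eq_pow_sum]
  rfl

theorem wtK_smul_one {K : Type} [Field K] {n p q : ℕ} (a b : K) (I J : TIdx n p q) :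
    wtK (a • (1 : Matrix (Fin n) (Fin n) K)) (b • 1) I J
      = if I = J then a ^ p * b ^ q else 0 := by
  split_ifs with h
  · subst h
    simp [wtK]
  · rw [wtK]
    by_cases h1 : I.1 = J.1
    · have h2 : I.2 ≠ J.2 := fun h2 => h (Prod.ext h1 h2)
      obtain ⟨t, ht⟩ := Function.ne_iff.mp h2
      rw [Finset.prod_eq_zero (i := t) (Finset.mem_univ t), mul_zero]
      simp [Matrix.one_apply_ne ht.symm]
    · obtain ⟨t, ht⟩ := Function.ne_iff.mp h1
      rw [Finset.prod_eq_zero (i := t) (Finset.mem_univ t), zero_mul]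
      simp [Matrix.one_apply_ne ht]

theorem kAct_smul_one {K : Type} [Field K] {n p q : ℕ} (a b : K) (w : TConst K n p q)
    (I : TIdx n p q) :
    kAct (a • (1 : Matrix (Fin n) (Fin n) K)) (b • 1) w I = a ^ p * b ^ q * w I := by
  simp [kAct, wtK_smul_one]

theorem coeff_tAct_smul_one {K : Type} [Field K] {n p q : ℕ} (a b : K) (v : TField K n p q)
    (I : TIdx n p q) (m : Fin n →₀ ℕ) :
    (tAct (a • (1 : Matrix (Fin n) (Fin n) K)) (b • 1) v I).coeff m
      = a ^ p * b ^ q * b ^ (m.sum fun _ e => e) * (v I).coeff m := by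
  simp [tAct, wtK_smul_one, coeff_polyComp_smul_one, ite_smul, mul_assoc]

/-- Every assignment of the coordinates of `J^k V` comes from a polynomial tensor field. -/
theorem exists_tField_coeff_eq {K : Type} [Field K] {n p q k : ℕ} (x : CIdx n p q k → K) :
    ∃ v : TField K n p q, (∀ I, (v I).totalDegree ≤ k) ∧
      ∀ s : CIdx n p q k, (v s.1).coeff s.2.1 = x s := by
  classical
  have : Finite {m : Fin n →₀ ℕ // (m.sum fun _ e => e) ≤ k} :=
    (Finsupp.finite_of_degree_le k).to_subtype
  have := Fintype.ofFinite {m : Fin n →₀ ℕ // (m.sum fun _ e => e) ≤ k}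
  refine ⟨fun I => ∑ m : {m : Fin n →₀ ℕ // (m.sum fun _ e => e) ≤ k},
    monomial m.1 (x (I, m)), fun I => ?_, fun s => ?_⟩
  · exact totalDegree_finsetSum_le fun m _ => (totalDegree_monomial_le _ _).trans m.2
  · simp [coeff_sum, coeff_monomial, Subtype.val_inj]

theorem exists_mem_support_of_eval_ne {K σ : Type*} [Field K] {f : MvPolynomial σ K}
    {x y : σ → K} (h : eval x f ≠ eval y f) :
    ∃ e ∈ f.support, ∃ s ∈ e.support, x s ≠ y s := by
  contrapose! h
  rw [eval_eq, eval_eq]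
  exact Finset.sum_congr rfl fun e he => congrArg _ <|
    Finset.prod_congr rfl fun s hs => by rw [h e he s hs]

/-- If evaluation of `f` is multiplied by `μ` when the variables are rescaled by `c`, then every
monomial of `f` has weight `μ`. -/
theorem prod_pow_eq_of_mem_support {K σ : Type*} [Field K] [Infinite K] {f : MvPolynomial σ K}
    {c : σ → K} {μ : K} (h : ∀ x : σ → K, eval (fun s => c s * x s) f = μ * eval x f)
    {e : σ →₀ ℕ} (he : e ∈ f.support) : (e.prod fun s j => c s ^ j) = μ := by
  have hf : bind₁ (fun s => C (c s) * X s) f = C μ * f := by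
    refine MvPolynomial.funext fun x => ?_
    rw [eval_mul, eval_C, ← h x]
    change eval₂Hom _ _ _ = eval₂Hom _ _ _
    rw [eval₂Hom_bind₁]
    simp
  have hc := congrArg (coeff e) hf
  rw [coeff_bind₁_C_mul_X, coeff_C_mul] at hc
  exact mul_right_cancel₀ (mem_support_iff.mp he) hc

theorem zpow_finsetSum₀ {K σ : Type*} [Field K] {a : K} (ha : a ≠ 0) (t : Finset σ) (g : σ → ℤ) :
    a ^ (∑ s ∈ t, g s) = ∏ s ∈ t, a ^ g s := by
  classical
  induction t using Finset.induction_on with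
  | empty => simp
  | insert b t hb ih => rw [Finset.sum_insert hb, Finset.prod_insert hb, zpow_add₀ ha, ih]

theorem two_zpow_injective (K : Type*) [Field K] [CharZero K] :
    Function.Injective fun a : ℤ => (2 : K) ^ a := fun a b hab =>
  zpow_right_injective₀ (a := (2 : ℚ)) (by norm_num) (by norm_num) <|
    Rat.cast_injective (α := K) <| by
      beta_reduce at hab ⊢
      rw [Rat.cast_zpow, Rat.cast_zpow, Rat.cast_ofNat, hab]

/-- The weight identity satisfied by the monomials of an equivariant polynomial map, coming from
equivariance under the homothety of ratio `2`. -/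
theorem sum_weight_eq_of_equivariant {K : Type} [Field K] [CharZero K] {n k p q p' q' : ℕ}
    {F : TIdx n p' q' → MvPolynomial (CIdx n p q k) K}
    (hequiv : ∀ A Ai : Matrix (Fin n) (Fin n) K, A * Ai = 1 → Ai * A = 1 →
      ∀ v : TField K n p q, (∀ idx, (v idx).totalDegree ≤ k) →
        evalPoly F (tAct A Ai v) = kAct A Ai (evalPoly F v))
    {κ : TIdx n p' q'} {e : CIdx n p q k →₀ ℕ} (he : e ∈ (F κ).support) :
    (e.sum fun s j => (j : ℤ) * ((p : ℤ) - q - (s.2.1.sum fun _ i => i : ℕ)))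
      = (p' : ℤ) - q' := by
  have h2 : (2 : K) ≠ 0 := two_ne_zero
  have hz : ∀ a b c : ℕ, (2 : K) ^ a * 2⁻¹ ^ b * 2⁻¹ ^ c = 2 ^ ((a : ℤ) - b - c) := by
    intro a b c
    rw [zpow_sub₀ h2, zpow_sub₀ h2]
    simp [div_eq_mul_inv]
  have key := prod_pow_eq_of_mem_support (f := F κ)
    (c := fun s => (2 : K) ^ ((p : ℤ) - q - (s.2.1.sum fun _ i => i : ℕ)))
    (μ := (2 : K) ^ ((p' : ℤ) - q')) (fun x => ?_) he
  · have hprod : (e.prod fun s j =>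
          ((2 : K) ^ ((p : ℤ) - q - (s.2.1.sum fun _ i => i : ℕ))) ^ j)
        = (2 : K) ^ (e.sum fun s j =>
          (j : ℤ) * ((p : ℤ) - q - (s.2.1.sum fun _ i => i : ℕ))) := by
      rw [Finsupp.prod, Finsupp.sum, zpow_finsetSum₀ h2]
      exact Finset.prod_congr rfl fun s _ => by rw [mul_comm, zpow_mul, zpow_natCast]
    rw [hprod] at key
    exact two_zpow_injective K key
  · obtain ⟨v, hv, hx⟩ := exists_tField_coeff_eq x
    have h := congrFun (hequiv ((2 : K) • 1) ((2 : K)⁻¹ • 1) (by simp [smul_smul])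
      (by simp [smul_smul]) v hv) κ
    rw [kAct_smul_one] at h
    simp only [evalPoly, coeff_tAct_smul_one, hx, hz] at h
    have h0 := hz p' q' 0
    rw [pow_zero, mul_one, Nat.cast_zero, sub_zero] at h0
    rw [h, h0]

/-- **Linear bound on the order of natural operations.** Let `δ : J^k V → W` be a
`GL(n,K)`-equivariant polynomial map, homogeneous of degree `d` (given by coordinate
polynomials `F`), where `V = T^p_q` and `W = T^{p'}_{q'}`. If `δ` does not factor through
`J^{k-1} V` (it depends nontrivially on the top component), then
`k ≤ (q' − p') + d (p − q)`. -/
theorem natural_operation_order_bound (K : Type) [Field K] [CharZero K]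
    (n k d p q p' q' : ℕ) (hn : 1 ≤ n)
    (F : TIdx n p' q' → MvPolynomial (CIdx n p q k) K)
    (hhom : ∀ κ, (F κ).IsHomogeneous d)
    (hequiv : ∀ A Ai : Matrix (Fin n) (Fin n) K, A * Ai = 1 → Ai * A = 1 →
      ∀ v : TField K n p q, (∀ idx, (v idx).totalDegree ≤ k) →
        evalPoly F (tAct A Ai v) = kAct A Ai (evalPoly F v))
    (hnontriv : ∃ v w : TField K n p q,
      (∀ idx, (v idx).totalDegree ≤ k) ∧ (∀ idx, (w idx).totalDegree ≤ k) ∧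
      (∀ idx (m : Fin n →₀ ℕ), (m.sum fun _ e => e) < k →
        (v idx).coeff m = (w idx).coeff m) ∧
      evalPoly F v ≠ evalPoly F w) :
    (k : ℤ) ≤ ((q' : ℤ) - (p' : ℤ)) + d * ((p : ℤ) - (q : ℤ)) := by
  obtain ⟨v, w, -, -, hvw, hne⟩ := hnontriv
  obtain ⟨κ, hκ⟩ := Function.ne_iff.mp hne
  obtain ⟨e, he, s, hs, hsne⟩ := exists_mem_support_of_eval_ne hκ
  have hks : k ≤ s.2.1.sum fun _ i => i := not_lt.mp fun h => hsne (hvw s.1 s.2.1 h)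
  have hd : ∑ t ∈ e.support, (e t : ℤ) = d := by
    have := (hhom κ).degree_eq_sum_deg_support he
    exact_mod_cast this.symm
  have hw := sum_weight_eq_of_equivariant hequiv he
  simp only [Finsupp.sum, mul_sub, Finset.sum_sub_distrib, ← Finset.sum_mul, hd] at hw
  have hle : ((e s : ℤ) * ((s.2.1.sum fun _ i => i : ℕ) : ℤ))
      ≤ ∑ t ∈ e.support, (e t : ℤ) * ((t.2.1.sum fun _ i => i : ℕ) : ℤ) :=
    Finset.single_le_sum (f := fun t : CIdx n p q k =>
      (e t : ℤ) * ((t.2.1.sum fun _ i => i : ℕ) : ℤ)) (fun t _ => by positivity) hs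
  have hes : (1 : ℤ) ≤ e s := by
    exact_mod_cast Nat.one_le_iff_ne_zero.mpr (Finsupp.mem_support_iff.mp hs)
  have hks' : (k : ℤ) ≤ ((s.2.1.sum fun _ i => i : ℕ) : ℤ) := by exact_mod_cast hks
  simp only [Finsupp.sum] at hle hks'
  nlinarith
end

section
/- Let K be a field of characteristic zero, V = K^n with standard basis (e_i) and dual basis (e^i), and let GL(V) act diagonally on V^{⊗p} ⊗ (V^*)^{⊗q} (by A on each factor V and by ξ ↦ ξ∘A^{-1} on each factor V^*). Then: (i) if p ≠ q, the only GL(V)-invariant element of V^{⊗p} ⊗ (V^*)^{⊗q} is 0; (ii) if p = q, the space of GL(V)-invariant elements is spanned by the tensors c_σ for σ in the symmetric group S_p, where c_σ = Σ_{i_1,…,i_p = 1}^n e_{i_1} ⊗ ⋯ ⊗ e_{i_p} ⊗ e^{i_{σ(1)}} ⊗ ⋯ ⊗ e^{i_{σ(p)}}. (First fundamental theorem of invariant theory for GL: every GL-equivariant tensor construction is built from contractions, identity operators, and permutations of indices.) -/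
open Matrix in
/-- Double centralizer theorem for a matrix representation of a finite group: a matrix commuting
with the commutant of the representation lies in its linear span. -/
theorem mem_span_range_of_forall_commute {K X G : Type*} [Field K] [CharZero K] [Fintype X]
    [DecidableEq X] [Group G] [Fintype G] (R : G →* Matrix X X K) (T : Matrix X X K)
    (hT : ∀ S : Matrix X X K, (∀ g, Commute S (R g)) → Commute S T) :
    T ∈ Submodule.span K (Set.range R) := by
  set B := Submodule.span K (Set.range R)
  have hRB : ∀ g, ∀ b ∈ B, R g * b ∈ B := by
    intro g b hb
    induction hb using Submodule.span_induction with
    | mem x hx =>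
      obtain ⟨h, rfl⟩ := hx
      exact Submodule.subset_span ⟨g * h, map_mul R g h⟩
    | zero => simp
    | add x y _ _ hx hy => rw [mul_add]; exact B.add_mem hx hy
    | smul a x _ hx => rw [mul_smul_comm]; exact B.smul_mem a hx
  obtain ⟨proj, hproj⟩ := B.subtype.exists_leftInverse_of_injective B.ker_subtype
  -- the (unnormalized) average of the projection over the group
  let π : Matrix X X K →ₗ[K] Matrix X X K :=
    ∑ g, LinearMap.mulLeft K (R g⁻¹) ∘ₗ B.subtype ∘ₗ proj ∘ₗ LinearMap.mulLeft K (R g)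
  have hπ : ∀ S, π S = ∑ g, R g⁻¹ * (proj (R g * S) : Matrix X X K) := by
    intro S; simp [π, LinearMap.sum_apply]
  have hπmem : ∀ S, π S ∈ B := fun S ↦ by
    rw [hπ]
    exact B.sum_mem fun g _ ↦ hRB _ _ (proj _).2
  have hπone : π 1 = (Fintype.card G : K) • (1 : Matrix X X K) := by
    rw [hπ]
    have : ∀ g, R g⁻¹ * (proj (R g * 1) : Matrix X X K) = 1 := by
      intro g
      have h := LinearMap.congr_fun hproj ⟨R g, Submodule.subset_span ⟨g, rfl⟩⟩
      simp only [LinearMap.comp_apply, Submodule.subtype_apply, LinearMap.id_apply] at h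
      rw [mul_one, h, ← map_mul, inv_mul_cancel, map_one]
    rw [Finset.sum_congr rfl fun g _ ↦ this g]
    simp [Nat.cast_smul_eq_nsmul]
  have hπR : ∀ h S, π (R h * S) = R h * π S := by
    intro h S
    rw [hπ, hπ, Finset.mul_sum]
    refine Fintype.sum_equiv (Equiv.mulRight h) _ _ fun g ↦ ?_
    simp only [Equiv.coe_mulRight, ← mul_assoc, ← map_mul, _root_.mul_inv_rev, mul_inv_cancel,
      one_mul]
  let C : X → X → Matrix X X K := fun j l ↦ of fun i k ↦ π (single k l 1) i j
  have hC : ∀ S i j, π S i j = ∑ l, (C j l * S) i l := by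
    intro S i j
    conv_lhs => rw [matrix_eq_sum_single S]
    simp only [map_sum, Matrix.sum_apply, mul_apply, C, of_apply]
    rw [Finset.sum_comm]
    refine Finset.sum_congr rfl fun l _ ↦ Finset.sum_congr rfl fun k _ ↦ ?_
    have : single k l (S k l) = S k l • single k l (1 : K) := by simp
    rw [this, map_smul, Matrix.smul_apply, smul_eq_mul, mul_comm]
  have hCR : ∀ j l g, Commute (C j l) (R g) := by
    intro j l g
    ext i k
    have h := congrFun (congrFun (hπR g (single k l 1)) i) j
    rw [hC, Finset.sum_eq_single l (fun b _ hb ↦ by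
      rw [← mul_assoc]; exact mul_single_apply_of_ne _ _ _ _ _ hb _) (by simp), ← mul_assoc,
      mul_single_apply_same, mul_one] at h
    rw [h]
    simp [mul_apply, C]
  have hπT : π (T * 1) = T * π 1 := by
    ext i j
    rw [hC, mul_apply]
    simp_rw [hC, Finset.mul_sum]
    rw [Finset.sum_comm]
    refine Finset.sum_congr rfl fun l _ ↦ ?_
    rw [← mul_assoc, (hT (C j l) (hCR j l)).eq, mul_assoc, mul_apply]
  rw [hπone, mul_smul_comm, mul_one] at hπT
  have hcard : (Fintype.card G : K) ≠ 0 := Nat.cast_ne_zero.2 Fintype.card_ne_zero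
  exact (B.smul_mem_iff hcard).1 (hπT ▸ hπmem T)

/-- The action of place permutations on the `p`-th tensor power, as matrices. -/
def placePerm (K : Type*) [Field K] (n p : ℕ) :
    Equiv.Perm (Fin p) →* Matrix (Fin p → Fin n) (Fin p → Fin n) K where
  toFun σ := Matrix.of fun I J ↦ if J = I ∘ σ then 1 else 0
  map_one' := by
    ext I J
    simp [Matrix.one_apply, eq_comm]
  map_mul' σ τ := by
    ext I J
    rw [Matrix.mul_apply, Finset.sum_eq_single (I ∘ σ)]
    · simp [Function.comp_assoc]
      rfl
    · intro L _ hL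
      simp [hL]
    · simp

theorem commute_placePerm_iff {K : Type*} [Field K] {n p : ℕ}
    (S : Matrix (Fin p → Fin n) (Fin p → Fin n) K) (σ : Equiv.Perm (Fin p)) :
    Commute S (placePerm K n p σ) ↔ ∀ I J, S (I ∘ σ) (J ∘ σ) = S I J := by
  have hL : ∀ I J, (S * placePerm K n p σ) I (J ∘ σ) = S I J := by
    intro I J
    rw [Matrix.mul_apply, Finset.sum_eq_single J]
    · simp [placePerm]
    · intro b _ hb
      have : J ∘ σ ≠ b ∘ σ := fun h ↦ hb (σ.surjective.injective_comp_right h).symm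
      simp [placePerm, this]
    · simp
  have hR : ∀ I J, (placePerm K n p σ * S) I J = S (I ∘ σ) J := by
    intro I J
    simp [placePerm, Matrix.mul_apply]
  constructor
  · intro h I J
    rw [← hR, ← h.eq, hL]
  · intro h
    ext I J
    obtain ⟨J, rfl⟩ : ∃ J', J = J' ∘ σ := ⟨J ∘ σ.symm, by ext; simp⟩
    rw [hL, hR, h]

/-- The `p`-th Kronecker power of a matrix. -/
def tensorPow {R : Type*} [CommSemiring R] {n : ℕ} (p : ℕ) (A : Matrix (Fin n) (Fin n) R) :
    Matrix (Fin p → Fin n) (Fin p → Fin n) R :=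
  Matrix.of fun I J ↦ ∏ s, A (I s) (J s)

theorem tensorPow_mul {R : Type*} [CommSemiring R] {n : ℕ} (p : ℕ)
    (A B : Matrix (Fin n) (Fin n) R) : tensorPow p (A * B) = tensorPow p A * tensorPow p B := by
  ext I J
  simp only [tensorPow, Matrix.of_apply, Matrix.mul_apply, Finset.prod_univ_sum,
    Fintype.piFinset_univ, Finset.prod_mul_distrib]

theorem tensorPow_one {R : Type*} [CommSemiring R] {n : ℕ} (p : ℕ) :
    tensorPow p (1 : Matrix (Fin n) (Fin n) R) = 1 := by
  ext I J
  simp [tensorPow, Matrix.one_apply, Finset.prod_ite_zero, funext_iff]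

theorem kAct_eq_tensorPow {K : Type} [Field K] {n p q : ℕ} (A Ai : Matrix (Fin n) (Fin n) K)
    (T : TConst K n p q) (I : Fin p → Fin n) (J : Fin q → Fin n) :
    kAct A Ai T (I, J) =
      (tensorPow p A * (Matrix.of fun I J ↦ T (I, J)) * tensorPow q Ai) I J := by
  simp only [kAct, wtK, tensorPow, Matrix.mul_apply, Matrix.of_apply, Fintype.sum_prod_type,
    Finset.sum_mul]
  rw [Finset.sum_comm]
  exact Finset.sum_congr rfl fun _ _ ↦ Finset.sum_congr rfl fun _ _ ↦ by ring

/-- The exponent of the monomial `∏ s, X (I s, J s)`. -/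
noncomputable def pairExponent {n p : ℕ} (I J : Fin p → Fin n) : Fin n × Fin n →₀ ℕ :=
  ∑ s, Finsupp.single (I s, J s) 1

theorem exists_perm_of_pairExponent_eq {n p : ℕ} {I J I' J' : Fin p → Fin n}
    (h : pairExponent I J = pairExponent I' J') :
    ∃ σ : Equiv.Perm (Fin p), I' = I ∘ σ ∧ J' = J ∘ σ := by
  have key : ∀ (I J : Fin p → Fin n) x,
      pairExponent I J x = Fintype.card {s // (I s, J s) = x} := by
    intro I J x
    simp [pairExponent, Finsupp.finsetSum_apply, Finsupp.single_apply, Fintype.card_subtype]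
  have e : ∀ x, Nonempty ({s // (I' s, J' s) = x} ≃ {s // (I s, J s) = x}) := fun x ↦
    Fintype.card_eq.1 (by rw [← key, ← key, h])
  let σ := Equiv.ofFiberEquiv (f := fun s ↦ (I' s, J' s)) (g := fun s ↦ (I s, J s))
    fun x ↦ (e x).some
  have hσ : ∀ s, (I (σ s), J (σ s)) = (I' s, J' s) :=
    Equiv.ofFiberEquiv_map (f := fun s ↦ (I' s, J' s)) (g := fun s ↦ (I s, J s)) _
  exact ⟨σ, funext fun s ↦ (congrArg Prod.fst (hσ s)).symm,
    funext fun s ↦ (congrArg Prod.snd (hσ s)).symm⟩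

theorem tensorPow_mvPolynomialX_apply {K : Type*} [Field K] {n p : ℕ} (I J : Fin p → Fin n) :
    tensorPow p (Matrix.mvPolynomialX (Fin n) (Fin n) K) I J =
      MvPolynomial.monomial (pairExponent I J) 1 := by
  simp [tensorPow, pairExponent, MvPolynomial.monomial_sum_one, MvPolynomial.X]

/-- A polynomial identity in the entries of a matrix may be checked on invertible matrices. -/
theorem MvPolynomial.eq_zero_of_eval_isUnit_det {K : Type*} [Field K] [Infinite K] {n : ℕ}
    (f : MvPolynomial (Fin n × Fin n) K)
    (hf : ∀ A : Matrix (Fin n) (Fin n) K, IsUnit A.det → eval (fun ij ↦ A ij.1 ij.2) f = 0) :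
    f = 0 := by
  have hdet := Matrix.det_mvPolynomialX_ne_zero (Fin n) K
  refine (mul_eq_zero.1 (?_ : f * (Matrix.mvPolynomialX (Fin n) (Fin n) K).det = 0)).resolve_right
    hdet
  refine MvPolynomial.funext fun x ↦ ?_
  let A : Matrix (Fin n) (Fin n) K := Matrix.of fun i j ↦ x (i, j)
  have hA : eval x (Matrix.mvPolynomialX (Fin n) (Fin n) K).det = A.det := by
    rw [RingHom.map_det]
    congr 1
    ext i j
    simp [A]
  rw [map_mul, map_zero, hA]
  by_cases h : A.det = 0
  · rw [h, mul_zero]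
  · rw [show x = fun ij ↦ A ij.1 ij.2 from rfl, hf A (isUnit_iff_ne_zero.2 h), zero_mul]

theorem commute_of_commute_tensorPow {K : Type*} [Field K] [Infinite K] {n p : ℕ}
    (T S : Matrix (Fin p → Fin n) (Fin p → Fin n) K)
    (hT : ∀ A : Matrix (Fin n) (Fin n) K, IsUnit A.det → Commute (tensorPow p A) T)
    (hS : ∀ σ, Commute S (placePerm K n p σ)) : Commute S T := by
  have hpoly : ∀ I J,
      ∑ L, MvPolynomial.monomial (pairExponent I L) (T L J) =
        ∑ L, MvPolynomial.monomial (pairExponent L J) (T I L) := by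
    intro I J
    rw [← sub_eq_zero]
    refine MvPolynomial.eq_zero_of_eval_isUnit_det _ fun A hA ↦ ?_
    have hmon : ∀ (I J : Fin p → Fin n) (a : K), MvPolynomial.eval (fun ij ↦ A ij.1 ij.2)
        (MvPolynomial.monomial (pairExponent I J) a) = a * tensorPow p A I J := by
      intro I J a
      have : MvPolynomial.monomial (pairExponent I J) a =
          a • MvPolynomial.monomial (pairExponent I J) 1 := by simp [MvPolynomial.smul_monomial]
      rw [this, ← tensorPow_mvPolynomialX_apply]
      simp [tensorPow]
    have h := congrFun (congrFun (hT A hA).eq I) J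
    simp only [Matrix.mul_apply] at h
    simp only [map_sub, map_sum, hmon, sub_eq_zero, ← h]
    exact Finset.sum_congr rfl fun _ _ ↦ mul_comm _ _
  classical
  have hcoeff : ∀ I J m, (∑ L, if pairExponent I L = m then T L J else 0) =
      ∑ L, if pairExponent L J = m then T I L else 0 := by
    intro I J m
    simpa [MvPolynomial.coeff_sum, MvPolynomial.coeff_monomial] using
      congrArg (MvPolynomial.coeff m) (hpoly I J)
  let E : Finset (Fin n × Fin n →₀ ℕ) :=
    Finset.univ.image fun IJ : (Fin p → Fin n) × (Fin p → Fin n) ↦ pairExponent IJ.1 IJ.2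
  have hfactors : (fun IJ : (Fin p → Fin n) × (Fin p → Fin n) ↦ S IJ.1 IJ.2).FactorsThrough
      fun IJ ↦ pairExponent IJ.1 IJ.2 := by
    intro a b hab
    obtain ⟨σ, h1, h2⟩ := exists_perm_of_pairExponent_eq hab
    simp only [h1, h2, (commute_placePerm_iff S σ).1 (hS σ)]
  obtain ⟨φ, hφ'⟩ := (Function.factorsThrough_iff _).1 hfactors
  have hφ : ∀ I J, S I J = φ (pairExponent I J) := fun I J ↦ congrFun hφ' (I, J)
  have hexp : ∀ I J, S I J = ∑ m ∈ E, if pairExponent I J = m then φ m else 0 := by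
    intro I J
    rw [Finset.sum_ite_eq, if_pos (Finset.mem_image.2 ⟨(I, J), Finset.mem_univ _, rfl⟩), hφ]
  ext I J
  simp only [Matrix.mul_apply, hexp, Finset.sum_mul, Finset.mul_sum]
  rw [Finset.sum_comm, Finset.sum_comm (t := E)]
  refine Finset.sum_congr rfl fun m _ ↦ ?_
  have h := congrArg (fun x ↦ φ m * x) (hcoeff I J m)
  simp only [Finset.mul_sum, mul_ite, mul_zero] at h
  simp only [ite_mul, zero_mul, h, mul_comm (T _ _)]

theorem eq_zero_of_kAct_smul_one {K : Type} [Field K] [CharZero K] {n p q : ℕ} (hpq : p ≠ q)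
    (T : TConst K n p q) (h : kAct ((2 : K) • 1) ((2 : K)⁻¹ • 1) T = T) : T = 0 := by
  have hpow : ∀ (r : ℕ) (a : K),
      tensorPow r (a • (1 : Matrix (Fin n) (Fin n) K)) = a ^ r • 1 := by
    intro r a
    rw [← tensorPow_one]
    ext I J
    simp only [tensorPow, Matrix.of_apply, Matrix.smul_apply, smul_eq_mul,
      Finset.prod_mul_distrib, Finset.prod_const, Finset.card_univ, Fintype.card_fin]
  funext ⟨I, J⟩
  have hIJ := congrFun h (I, J)
  rw [kAct_eq_tensorPow, hpow, hpow] at hIJ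
  rw [Matrix.smul_mul, Matrix.one_mul, Matrix.mul_smul, Matrix.mul_one] at hIJ
  simp only [Matrix.smul_apply, Matrix.of_apply, smul_eq_mul, inv_pow] at hIJ
  by_contra hne
  have h2 : (2 : K) ^ p = 2 ^ q := by
    have h0 : (2 : K) ^ q ≠ 0 := pow_ne_zero _ two_ne_zero
    rw [← mul_assoc, mul_eq_right₀ hne, inv_mul_eq_one₀ h0] at hIJ
    exact hIJ.symm
  exact hpq (Nat.pow_right_injective le_rfl (by exact_mod_cast h2))

/-- **First fundamental theorem of invariant theory for `GL`.** Let `T` be a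
`GL(V)`-invariant element of `V^{⊗p} ⊗ (V^*)^{⊗q}`, `V = K^n`. Then:
(i) if `p ≠ q` then `T = 0`;
(ii) if `p = q`, `T` lies in the span of the tensors
`c_σ = Σ_{i_1,…,i_p} e_{i_1}⊗⋯⊗e_{i_p}⊗e^{i_{σ(1)}}⊗⋯⊗e^{i_{σ(p)}}`, `σ ∈ S_p`
(whose coordinates are `c_σ(I,J) = 1` if `J(t) = I(σ(t))` for all `t`, else `0`). -/
theorem fft_general_linear_group (K : Type) [Field K] [CharZero K]
    (n p q : ℕ) (hn : 1 ≤ n)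
    (T : TConst K n p q)
    (hinv : ∀ A Ai : Matrix (Fin n) (Fin n) K, A * Ai = 1 → Ai * A = 1 →
      kAct A Ai T = T) :
    (p ≠ q → T = 0) ∧
    (∀ hpq : p = q,
      T ∈ Submodule.span K (Set.range (fun σ : Equiv.Perm (Fin p) =>
        (fun IJ : TIdx n p q =>
          if ∀ t : Fin q, IJ.2 t = IJ.1 (σ (Fin.cast hpq.symm t)) then (1 : K) else 0)))) := by
  constructor
  · intro hpq
    refine eq_zero_of_kAct_smul_one hpq T (hinv _ _ ?_ ?_) <;> simp [smul_smul]
  · rintro rfl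
    set M : Matrix (Fin p → Fin n) (Fin p → Fin n) K := Matrix.of fun I J ↦ T (I, J) with hM
    have hcomm : ∀ A : Matrix (Fin n) (Fin n) K, IsUnit A.det → Commute (tensorPow p A) M := by
      intro A hA
      have h : tensorPow p A * M * tensorPow p A⁻¹ = M := by
        ext I J
        rw [← kAct_eq_tensorPow,
          hinv A A⁻¹ (Matrix.mul_nonsing_inv A hA) (Matrix.nonsing_inv_mul A hA), hM,
          Matrix.of_apply]
      have h' := congrArg (· * tensorPow p A) h
      simp only [mul_assoc, ← tensorPow_mul, Matrix.nonsing_inv_mul A hA, tensorPow_one,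
        mul_one] at h'
      exact h'
    have hspan := mem_span_range_of_forall_commute (placePerm K n p) M fun S hS ↦
      commute_of_commute_tensorPow M S hcomm hS
    let uncurry : Matrix (Fin p → Fin n) (Fin p → Fin n) K →ₗ[K] TConst K n p p :=
      { toFun := fun S IJ ↦ S IJ.1 IJ.2
        map_add' := fun _ _ ↦ rfl
        map_smul' := fun _ _ ↦ rfl }
    have hmap : T ∈ (Submodule.span K (Set.range (placePerm K n p))).map uncurry :=
      Submodule.mem_map_of_mem hspan
    rw [Submodule.map_span, ← Set.range_comp] at hmap
    convert hmap using 3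
    funext σ IJ
    change _ = placePerm K n p σ IJ.1 IJ.2
    simp [placePerm, funext_iff]
end

section
/- Let K be a field of characteristic zero, n ≥ 1, and V = K^{2n} with the standard symplectic form ω_0. Call a multilinear form T : V^m → K Sp-invariant if T(g v_1,…,g v_m) = T(v_1,…,v_m) for all g ∈ Sp(2n,K). Then: (i) if m is odd, every Sp-invariant multilinear form on V^m is zero; (ii) if m = 2p, the space of Sp-invariant multilinear forms is spanned by the forms T_M, where M = {{a_1,b_1},…,{a_p,b_p}} (a_i < b_i) runs over the perfect matchings of {1,…,2p} and T_M(v_1,…,v_{2p}) = ∏_{i=1}^p ω_0(v_{a_i}, v_{b_i}). (First fundamental theorem of invariant theory for the symplectic group.) -/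
open scoped Classical

/-- The standard symplectic form `ω_0 = Σ_{i=1}^n dx_i ∧ dx_{n+i}` on `K^{2n}`
(written `n + n`), as a bilinear form on vectors. -/
def w0f (K : Type) [Field K] (n : ℕ) (u v : Fin (n + n) → K) : K :=
  ∑ i : Fin n, (u (Fin.castAdd n i) * v (Fin.natAdd n i)
    - u (Fin.natAdd n i) * v (Fin.castAdd n i))

section SymplecticInvariants

open Module Function

variable {K V ι : Type*} [Field K] [AddCommGroup V] [Module K V] [DecidableEq ι]

/-- The span of the products `∏ ω(v_{a_k}, v_{b_k})` over perfect matchings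
`{{a_1, b_1}, …, {a_p, b_p}}` of the index set. -/
def matchingSpan (ω : LinearMap.BilinForm K V) (ι : Type*) : Submodule K ((ι → V) → K) :=
  Submodule.span K {F | ∃ (p : ℕ) (a b : Fin p → ι), Bijective (Sum.elim a b) ∧
    F = fun v => ∏ k, ω (v (a k)) (v (b k))}

variable {ω : LinearMap.BilinForm K V}

theorem mul_mem_matchingSpan {i j : ι} (hij : i ≠ j)
    {F : ({l // l ≠ i ∧ l ≠ j} → V) → K} (hF : F ∈ matchingSpan ω {l // l ≠ i ∧ l ≠ j}) :
    (fun v : ι → V => ω (v j) (v i) * F (fun l => v l)) ∈ matchingSpan ω ι := by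
  induction hF using Submodule.span_induction with
  | mem F hF =>
    obtain ⟨p, a, b, hab, rfl⟩ := hF
    refine Submodule.subset_span ⟨p + 1, Fin.cons j fun k => a k, Fin.cons i fun k => b k, ?_, ?_⟩
    · constructor
      · have h := Sum.elim_injective.1 hab.1
        refine Sum.elim_injective.2
          ⟨Fin.cons_injective_iff.2 ⟨fun ⟨k, hk⟩ => (a k).2.2 hk, Subtype.val_injective.comp h.1⟩,
            Fin.cons_injective_iff.2
              ⟨fun ⟨k, hk⟩ => (b k).2.1 hk, Subtype.val_injective.comp h.2.1⟩, fun k l => ?_⟩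
        refine Fin.cases ?_ (fun k => ?_) k <;> refine Fin.cases ?_ (fun l => ?_) l
        · exact hij.symm
        · exact (b l).2.2.symm
        · exact (a k).2.1
        · exact fun hkl => h.2.2 k l (Subtype.ext hkl)
      · intro l
        by_cases hj : l = j
        · exact ⟨Sum.inl 0, hj.symm⟩
        by_cases hi : l = i
        · exact ⟨Sum.inr 0, hi.symm⟩
        obtain ⟨k | k, hk⟩ := hab.2 ⟨l, hi, hj⟩
        · exact ⟨Sum.inl k.succ, congrArg Subtype.val hk⟩
        · exact ⟨Sum.inr k.succ, congrArg Subtype.val hk⟩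
    · ext v
      simp [Fin.prod_univ_succ]
  | zero =>
    convert Submodule.zero_mem (matchingSpan ω ι) using 1
    ext v
    simp
  | add F G _ _ hF hG =>
    convert Submodule.add_mem _ hF hG using 1
    ext v
    simp [mul_add]
  | smul c F _ hF =>
    convert Submodule.smul_mem _ c hF using 1
    ext v
    simp [mul_left_comm]

section DualBases

variable {κ : Type*} [Fintype κ] [DecidableEq κ] (hω : ω.Nondegenerate) (b : Basis κ K V)

theorem sum_apply_mul_dualBasis (f : V →ₗ[K] K) (x : V) :
    ∑ a, ω x (b a) * f (ω.dualBasis hω b a) = f x := by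
  conv_rhs => rw [← (ω.dualBasis hω b).sum_repr x]
  simp

theorem sum_dualBasis_apply_mul (f : V →ₗ[K] K) (x : V) :
    ∑ a, ω (ω.dualBasis hω b a) x * f (b a) = f x := by
  have h (a : κ) : ω (ω.dualBasis hω b a) x = b.repr x a := by
    conv_lhs => rw [← b.sum_repr x]
    simp only [map_sum, map_smul, LinearMap.BilinForm.apply_dualBasis_left]
    simp
  conv_rhs => rw [← b.sum_repr x]
  simp only [map_sum, map_smul, smul_eq_mul, h]

/-- The contraction of a multilinear form in the arguments `i` and `j` against the bivector
dual to `ω`. -/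
noncomputable def pairContraction (T : MultilinearMap K (fun _ : ι => V) K) (i j : ι) :
    MultilinearMap K (fun _ : {l // l ≠ i ∧ l ≠ j} => V) K :=
  ∑ a, T.domDomRestrict (fun l => l ≠ i ∧ l ≠ j)
    (fun l => if l.1 = j then b a else ω.dualBasis hω b a)

theorem pairContraction_apply (T : MultilinearMap K (fun _ : ι => V) K) (i j : ι) (v : ι → V) :
    pairContraction hω b T i j (fun l => v l) =
      ∑ a, T (update (update v i (ω.dualBasis hω b a)) j (b a)) := by
  rw [pairContraction, sum_apply]
  refine Finset.sum_congr rfl fun a _ => ?_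
  rw [MultilinearMap.domDomRestrict_apply]
  congr 1
  ext l
  by_cases hj : l = j <;> by_cases hi : l = i <;> simp [update_apply, hi, hj]

end DualBases

/-- Antisymmetry of a multilinear form in the arguments indexed by `R`. -/
def AntisymmetricOn (T : MultilinearMap K (fun _ : ι => V) K) (R : Finset ι) : Prop :=
  ∀ i ∈ R, ∀ j ∈ R, i ≠ j → T.domDomCongr (Equiv.swap i j) = -T

theorem AntisymmetricOn.insert {T : MultilinearMap K (fun _ : ι => V) K} {R : Finset ι}
    (hT : AntisymmetricOn T R) {j : ι} (hj : j ∉ R) :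
    AntisymmetricOn (T - ∑ i ∈ R, T.domDomCongr (Equiv.swap i j)) (insert j R) := by
  have hcongr (σ : Equiv.Perm ι) :
      (T - ∑ i ∈ R, T.domDomCongr (Equiv.swap i j)).domDomCongr σ =
        T.domDomCongr σ - ∑ i ∈ R, T.domDomCongr (σ * Equiv.swap i j) := by
    ext v
    simp [MultilinearMap.domDomCongr_mul]
  have hlast : ∀ i ∈ R, (T - ∑ i ∈ R, T.domDomCongr (Equiv.swap i j)).domDomCongr
      (Equiv.swap i j) = -(T - ∑ i ∈ R, T.domDomCongr (Equiv.swap i j)) := by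
    intro i hi
    rw [hcongr, ← Finset.add_sum_erase _ _ hi, ← Finset.add_sum_erase R
      (fun i => T.domDomCongr (Equiv.swap i j)) hi]
    have h : ∀ k ∈ R.erase i, T.domDomCongr (Equiv.swap i j * Equiv.swap k j) =
        -T.domDomCongr (Equiv.swap k j) := by
      intro k hk
      have hkR := Finset.mem_of_mem_erase hk
      have hki := Finset.ne_of_mem_erase hk
      rw [Equiv.swap_mul_eq_mul_swap, MultilinearMap.domDomCongr_mul, Equiv.swap_inv,
        Equiv.swap_apply_right, Equiv.swap_apply_of_ne_of_ne hki.symm (ne_of_mem_of_not_mem hi hj),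
        hT i hi k hkR hki.symm]
      rfl
    have h1 : T.domDomCongr 1 = T := rfl
    rw [Finset.sum_congr rfl h, Equiv.swap_mul_self, Finset.sum_neg_distrib, h1]
    abel
  intro k hk l hl hkl
  rcases Finset.mem_insert.1 hk with rfl | hkR <;> rcases Finset.mem_insert.1 hl with rfl | hlR
  · exact absurd rfl hkl
  · rw [Equiv.swap_comm]
    exact hlast l hlR
  · exact hlast k hkR
  · have hmaps (i : ι) (hi : i ∈ R) : Equiv.swap k l i ∈ R := by
      rw [Equiv.swap_apply_def]
      split_ifs <;> assumption
    have hjfix : Equiv.swap k l j = j :=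
      Equiv.swap_apply_of_ne_of_ne (ne_of_mem_of_not_mem hkR hj).symm
        (ne_of_mem_of_not_mem hlR hj).symm
    have h : ∑ i ∈ R, T.domDomCongr (Equiv.swap k l * Equiv.swap i j) =
        -∑ i ∈ R, T.domDomCongr (Equiv.swap i j) := by
      rw [← Finset.sum_neg_distrib]
      refine Finset.sum_nbij' (Equiv.swap k l) (Equiv.swap k l) hmaps hmaps (by simp) (by simp) ?_
      intro i _
      rw [Equiv.mul_swap_eq_swap_mul, hjfix, MultilinearMap.domDomCongr_mul, hT k hkR l hlR hkl]
      rfl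
    rw [hcongr, h, hT k hkR l hlR hkl]
    abel

variable [Fintype ι]

/-- Multilinear forms annihilated by the infinitesimal transvections `v ↦ ω(v, u) u`. -/
def infinitesimalInvariants (ω : LinearMap.BilinForm K V) (ι : Type*) [Fintype ι]
    [DecidableEq ι] : Submodule K (MultilinearMap K (fun _ : ι => V) K) where
  carrier := {T | ∀ (u : V) (v : ι → V), ∑ i, ω (v i) u * T (update v i u) = 0}
  zero_mem' := by simp
  add_mem' := by
    intro S T hS hT u v
    simp only [add_apply, mul_add, Finset.sum_add_distrib, hS u v, hT u v, add_zero]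
  smul_mem' := by
    intro c T hT u v
    simp only [smul_apply, smul_eq_mul, mul_left_comm _ c, ← Finset.mul_sum,
      hT u v, mul_zero]

theorem sum_mul_apply_transvection_polarized {T : MultilinearMap K (fun _ : ι => V) K}
    (hT : T ∈ infinitesimalInvariants ω ι) (u w : V) (v : ι → V) :
    ∑ i, (ω (v i) u * T (update v i w) + ω (v i) w * T (update v i u)) = 0 := by
  have h := hT (u + w) v
  have hu := hT u v
  have hw := hT w v
  simp only [map_add, MultilinearMap.map_update_add, mul_add, add_mul,
    Finset.sum_add_distrib] at h ⊢
  linear_combination h - hu - hw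

theorem domDomCongr_mem_infinitesimalInvariants {T : MultilinearMap K (fun _ : ι => V) K}
    (hT : T ∈ infinitesimalInvariants ω ι) (σ : Equiv.Perm ι) :
    T.domDomCongr σ ∈ infinitesimalInvariants ω ι := by
  intro u v
  rw [← hT u (fun i => v (σ i)), ← Equiv.sum_comp σ]
  refine Finset.sum_congr rfl fun i _ => ?_
  rw [MultilinearMap.domDomCongr_apply]
  congr 2
  ext l
  simp [update_apply]

section DualBases

variable {κ : Type*} [Fintype κ] [DecidableEq κ] (hω : ω.Nondegenerate) (b : Basis κ K V)

theorem sum_eq_add_add_sum_subtype {i j : ι} (hij : i ≠ j) (f : ι → K) :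
    ∑ l, f l = f i + (f j + ∑ l : {l // l ≠ i ∧ l ≠ j}, f l) := by
  rw [← Finset.add_sum_erase _ f (Finset.mem_univ i),
    ← Finset.add_sum_erase _ f (Finset.mem_erase.2 ⟨hij.symm, Finset.mem_univ j⟩),
    Finset.sum_subtype ((Finset.univ.erase i).erase j) (p := fun l => l ≠ i ∧ l ≠ j)
      (by simp [and_comm])]

theorem pairContraction_mem_infinitesimalInvariants (halt : ω.IsAlt)
    {T : MultilinearMap K (fun _ : ι => V) K} (hT : T ∈ infinitesimalInvariants ω ι)
    {i j : ι} (hij : i ≠ j) :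
    pairContraction hω b T i j ∈ infinitesimalInvariants ω {l // l ≠ i ∧ l ≠ j} := by
  intro u x
  obtain ⟨v, rfl⟩ : ∃ v : ι → V, x = fun l => v l.1 :=
    ⟨fun l => if h : l ≠ i ∧ l ≠ j then x ⟨l, h⟩ else 0, by ext l; simp [l.2.1, l.2.2]⟩
  have hupd (l : {l // l ≠ i ∧ l ≠ j}) :
      update (fun l : {l // l ≠ i ∧ l ≠ j} => v l) l u =
        fun k : {l // l ≠ i ∧ l ≠ j} => update v l u k := by
    ext k
    simp [update_apply, Subtype.ext_iff]
  simp only [hupd, pairContraction_apply, Finset.mul_sum]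
  rw [Finset.sum_comm]
  have key (a : κ) : ∑ l : {l // l ≠ i ∧ l ≠ j}, ω (v l) u *
      T (update (update (update v l u) i (ω.dualBasis hω b a)) j (b a)) =
      ω u (b a) * T.toLinearMap (update v j u) i (ω.dualBasis hω b a)
      - ω (ω.dualBasis hω b a) u * T.toLinearMap (update v i u) j (b a) := by
    have h := hT u (update (update v i (ω.dualBasis hω b a)) j (b a))
    rw [sum_eq_add_add_sum_subtype hij] at h
    have hl : ∀ l : {l // l ≠ i ∧ l ≠ j}, ω (update (update v i (ω.dualBasis hω b a)) j (b a) l) u *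
        T (update (update (update v i (ω.dualBasis hω b a)) j (b a)) l u) = ω (v l) u *
        T (update (update (update v l u) i (ω.dualBasis hω b a)) j (b a)) := by
      intro l
      rw [update_of_ne l.2.2, update_of_ne l.2.1, update_comm l.2.2.symm, update_comm l.2.1.symm]
    simp only [hl] at h
    rw [update_of_ne hij, update_self, update_self, update_idem,
      update_comm hij.symm, update_idem] at h
    rw [← halt.neg_eq, MultilinearMap.toLinearMap_apply, MultilinearMap.toLinearMap_apply,
      update_comm hij.symm]
    linear_combination h
  simp only [key, Finset.sum_sub_distrib, sum_apply_mul_dualBasis, sum_dualBasis_apply_mul]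
  rw [MultilinearMap.toLinearMap_apply, MultilinearMap.toLinearMap_apply, update_comm hij, sub_self]

/-- The Casimir identity: on forms killed by the infinitesimal transvections, the sum of the
transpositions involving `i` is a scalar modulo contractions. -/
theorem casimir_identity {T : MultilinearMap K (fun _ : ι => V) K}
    (hT : T ∈ infinitesimalInvariants ω ι) (i : ι) (v : ι → V) :
    (Fintype.card κ + 1 : K) * T v + ∑ j ∈ Finset.univ.erase i,
      (T.domDomCongr (Equiv.swap i j) v +
        ω (v j) (v i) * pairContraction hω b T i j (fun l => v l)) = 0 := by
  have h := Finset.sum_congr (rfl : (Finset.univ : Finset κ) = Finset.univ) fun a _ =>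
    sum_mul_apply_transvection_polarized hT (b a) (v i) (update v i (ω.dualBasis hω b a))
  rw [Finset.sum_comm, ← Finset.add_sum_erase _ _ (Finset.mem_univ i)] at h
  simp only [Finset.sum_const_zero] at h
  rw [← h]
  congr 1
  · have := sum_dualBasis_apply_mul hω b (T.toLinearMap v i) (v i)
    simp only [MultilinearMap.toLinearMap_apply, update_eq_self] at this
    simp [Finset.sum_add_distrib, LinearMap.BilinForm.apply_dualBasis_left, this, add_mul]
  · refine Finset.sum_congr rfl fun j hj => ?_
    have hji : j ≠ i := Finset.ne_of_mem_erase hj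
    rw [pairContraction_apply, Finset.sum_add_distrib, Finset.mul_sum]
    simp only [update_of_ne hji]
    congr 1
    have := sum_apply_mul_dualBasis hω b (T.toLinearMap (update v j (v i)) i) (v j)
    simp only [MultilinearMap.toLinearMap_apply] at this
    simp only [update_comm hji] at this ⊢
    rw [this, MultilinearMap.domDomCongr_apply]
    congr 1
    ext l
    simp only [update_apply, Equiv.swap_apply_def]
    split_ifs <;> simp_all

end DualBases

theorem AntisymmetricOn.eq_zero [CharZero K] {κ : Type*} [Fintype κ] (b : Basis κ K V)
    {T : MultilinearMap K (fun _ : ι => V) K} {R : Finset ι} (hT : AntisymmetricOn T R)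
    (hR : Fintype.card κ < R.card) : T = 0 := by
  refine Basis.ext_multilinear (fun _ => b) fun f => ?_
  obtain ⟨i, hi, j, hj, hij, hf⟩ := Finset.exists_ne_map_eq_of_card_lt_of_maps_to
    (t := Finset.univ) (by simpa using hR) (f := f) (by simp [Set.MapsTo])
  have h := congrArg (fun S => S fun l => b (f l)) (hT i hi j hj hij)
  have hswap : (fun l => b (f (Equiv.swap i j l))) = fun l => b (f l) := by
    ext1 l
    rw [Equiv.swap_apply_def]
    split_ifs <;> simp_all
  simp only [MultilinearMap.domDomCongr_apply, hswap, neg_apply] at h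
  simpa using self_eq_neg.1 h

/-- If modulo a subspace `S` the sum of the transpositions through any fixed index acts on
invariants as `-(d + 1)`, where `d` is the dimension of `V`, then every invariant that is
antisymmetric in a nonempty set of arguments lies in `S`. -/
theorem AntisymmetricOn.mem [CharZero K] {κ : Type*} [Fintype κ] (b : Basis κ K V)
    (S : Submodule K (MultilinearMap K (fun _ : ι => V) K))
    (hS : ∀ T ∈ infinitesimalInvariants ω ι, ∀ i, (Fintype.card κ + 1 : K) • T +
      ∑ j ∈ Finset.univ.erase i, T.domDomCongr (Equiv.swap i j) ∈ S)
    {T : MultilinearMap K (fun _ : ι => V) K} (hT : T ∈ infinitesimalInvariants ω ι)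
    {R : Finset ι} (hR : R.Nonempty) (hanti : AntisymmetricOn T R) : T ∈ S := by
  induction hN : Fintype.card κ + 1 - R.card generalizing T R with
  | zero =>
    rw [hanti.eq_zero b (by omega)]
    exact S.zero_mem
  | succ N ih =>
    have hout : ∑ j ∈ Rᶜ, (T - ∑ i ∈ R, T.domDomCongr (Equiv.swap i j)) ∈ S := by
      refine S.sum_mem fun j hj => ?_
      rw [Finset.mem_compl] at hj
      refine ih (Submodule.sub_mem _ hT (Submodule.sum_mem _ fun i _ =>
        domDomCongr_mem_infinitesimalInvariants hT _)) (R.insert_nonempty j) (hanti.insert hj) ?_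
      rw [Finset.card_insert_of_notMem hj]
      omega
    have hin : ∑ i ∈ R, ((Fintype.card κ + 2 - R.card : K) • T +
        ∑ j ∈ Rᶜ, T.domDomCongr (Equiv.swap i j)) ∈ S := by
      refine S.sum_mem fun i hi => ?_
      convert hS T hT i using 1
      have hsplit : Finset.univ.erase i = R.erase i ∪ Rᶜ := by
        ext j
        by_cases hj : j ∈ R <;> simp [hj]
        rintro rfl
        exact hj hi
      have hdisj : Disjoint (R.erase i) Rᶜ :=
        disjoint_compl_right.mono_left (R.erase_subset i)
      have hneg : ∀ j ∈ R.erase i, T.domDomCongr (Equiv.swap i j) = -T := fun j hj =>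
        hanti i hi j (Finset.mem_of_mem_erase hj) (Finset.ne_of_mem_erase hj).symm
      rw [hsplit, Finset.sum_union hdisj, Finset.sum_congr rfl hneg, Finset.sum_const,
        Finset.card_erase_of_mem hi, ← Nat.cast_smul_eq_nsmul K,
        Nat.cast_sub (Finset.card_pos.2 hR)]
      module
    have hsum := S.add_mem hout hin
    rw [Finset.sum_sub_distrib, Finset.sum_add_distrib, Finset.sum_comm (s := R), Finset.sum_const,
      Finset.sum_const, ← Nat.cast_smul_eq_nsmul K, ← Nat.cast_smul_eq_nsmul K] at hsum
    have hcoef : ((Rᶜ.card + R.card * (Fintype.card κ + 2 - R.card) : ℕ) : K) • T ∈ S := by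
      convert hsum using 1
      push_cast [Nat.cast_sub (show R.card ≤ Fintype.card κ + 2 by omega)]
      module
    refine (S.smul_mem_iff (Nat.cast_ne_zero.2 ?_)).1 hcoef
    have := Nat.mul_pos (Finset.card_pos.2 hR) (show 0 < Fintype.card κ + 2 - R.card by omega)
    omega

/-- First fundamental theorem for a nondegenerate alternating form, with invariance under the
symplectic Lie algebra. -/
theorem coe_mem_matchingSpan [CharZero K] {κ : Type*} [Fintype κ] (b : Basis κ K V)
    (hω : ω.Nondegenerate) (halt : ω.IsAlt) {T : MultilinearMap K (fun _ : ι => V) K}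
    (hT : T ∈ infinitesimalInvariants ω ι) : ⇑T ∈ matchingSpan ω ι := by
  classical
  induction hN : Fintype.card ι using Nat.strong_induction_on generalizing ι with
  | _ N ih =>
  subst hN
  rcases isEmpty_or_nonempty ι with hι | ⟨⟨i₀⟩⟩
  · have h : ⇑T = T 0 • fun v => ∏ k : Fin 0, ω (v (Fin.elim0 k)) (v (Fin.elim0 k)) := by
      ext v
      simp [Subsingleton.elim v 0]
    rw [h]
    exact Submodule.smul_mem _ _ (Submodule.subset_span ⟨0, Fin.elim0, Fin.elim0,
      ⟨injective_of_subsingleton _, fun x => hι.elim x⟩, rfl⟩)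
  · let coeFn : MultilinearMap K (fun _ : ι => V) K →ₗ[K] (ι → V) → K :=
      { toFun := fun T => ⇑T, map_add' := fun _ _ => rfl, map_smul' := fun _ _ => rfl }
    refine AntisymmetricOn.mem b ((matchingSpan ω ι).comap coeFn) ?_ hT
      (Finset.singleton_nonempty i₀) ?_
    · intro T hT i
      have h : coeFn ((Fintype.card κ + 1 : K) • T +
          ∑ j ∈ Finset.univ.erase i, T.domDomCongr (Equiv.swap i j)) =
          -∑ j ∈ Finset.univ.erase i,
            fun v => ω (v j) (v i) * pairContraction hω b T i j (fun l => v l) := by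
        ext v
        have := casimir_identity hω b hT i v
        rw [Finset.sum_add_distrib] at this
        simp only [coeFn, LinearMap.coe_mk, AddHom.coe_mk, add_apply,
          smul_apply, smul_eq_mul, sum_apply, Pi.neg_apply,
          Finset.sum_apply]
        linear_combination this
      rw [Submodule.mem_comap, h]
      refine Submodule.neg_mem _ (Submodule.sum_mem _ fun j hj => ?_)
      have hij : i ≠ j := (Finset.ne_of_mem_erase hj).symm
      exact mul_mem_matchingSpan hij
        (ih _ (Fintype.card_subtype_lt (x := i) (by simp))
          (pairContraction_mem_infinitesimalInvariants hω b halt hT hij) rfl)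
    · intro i hi j hj hij
      simp_all

/-- Invariance under the transvections `v ↦ v + t ω(v, u) u` implies its infinitesimal version. -/
theorem mem_infinitesimalInvariants_of_transvections [Infinite K]
    {T : MultilinearMap K (fun _ : ι => V) K}
    (hT : ∀ (t : K) (u : V) (v : ι → V), T (fun i => v i + (t * ω (v i) u) • u) = T v) :
    T ∈ infinitesimalInvariants ω ι := by
  intro u v
  let c (s : Finset ι) : K := (∏ i ∈ s, ω (v i) u) * T (s.piecewise (fun _ => u) v)
  let P : Polynomial K := ∑ s : Finset ι, Polynomial.C (c s) * Polynomial.X ^ s.card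
  have hP : P = Polynomial.C (T v) := by
    refine Polynomial.funext fun t => ?_
    rw [Polynomial.eval_C, ← hT t u v]
    have hadd : (fun i => v i + (t * ω (v i) u) • u) =
        (fun i => (t * ω (v i) u) • u) + v := by
      ext1 i
      exact add_comm _ _
    rw [hadd, MultilinearMap.map_add_univ, Polynomial.eval_finsetSum]
    refine Finset.sum_congr rfl fun s _ => ?_
    have hpw : s.piecewise (fun i => (t * ω (v i) u) • u) v = s.piecewise
        (fun i => (t * ω (v i) u) • s.piecewise (fun _ => u) v i)
        (s.piecewise (fun _ => u) v) := by
      ext1 i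
      by_cases hi : i ∈ s <;> simp [hi]
    rw [hpw, MultilinearMap.map_piecewise_smul]
    simp only [c, Finset.prod_mul_distrib, Finset.prod_const, smul_eq_mul, Polynomial.eval_mul,
      Polynomial.eval_C, Polynomial.eval_pow, Polynomial.eval_X]
    ring
  have hcoeff := congrArg (fun Q => Q.coeff 1) hP
  simp only [P, Polynomial.finsetSum_coeff, Polynomial.coeff_C_mul, Polynomial.coeff_X_pow,
    Polynomial.coeff_C_of_ne_zero one_ne_zero, mul_ite, mul_one, mul_zero] at hcoeff
  rw [← Finset.sum_filter] at hcoeff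
  rw [← hcoeff]
  refine Finset.sum_bij (fun i _ => {i}) (by simp) (by simp) ?_ ?_
  · intro s hs
    obtain ⟨i, rfl⟩ := Finset.card_eq_one.1 (Finset.mem_filter.1 hs).2.symm
    exact ⟨i, Finset.mem_univ i, rfl⟩
  · intro i _
    simp [c, Finset.piecewise_singleton]

end SymplecticInvariants

/-- The standard symplectic form as a bilinear form. -/
def standardSymplecticForm (K : Type) [Field K] (n : ℕ) :
    LinearMap.BilinForm K (Fin (n + n) → K) :=
  LinearMap.mk₂ K (w0f K n)
    (fun u v w => by simp only [w0f, Pi.add_apply, ← Finset.sum_add_distrib]; congr! 1; ring)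
    (fun c u v => by
      simp only [w0f, Pi.smul_apply, smul_eq_mul, Finset.mul_sum]; congr! 1; ring)
    (fun u v w => by simp only [w0f, Pi.add_apply, ← Finset.sum_add_distrib]; congr! 1; ring)
    (fun c u v => by
      simp only [w0f, Pi.smul_apply, smul_eq_mul, Finset.mul_sum]; congr! 1; ring)

theorem standardSymplecticForm_apply (K : Type) [Field K] (n : ℕ) (u v : Fin (n + n) → K) :
    standardSymplecticForm K n u v = w0f K n u v := rfl

theorem standardSymplecticForm_isAlt (K : Type) [Field K] (n : ℕ) :
    (standardSymplecticForm K n).IsAlt := by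
  intro u
  simp [standardSymplecticForm_apply, w0f, mul_comm]

theorem standardSymplecticForm_nondegenerate (K : Type) [Field K] (n : ℕ) :
    (standardSymplecticForm K n).Nondegenerate := by
  refine (standardSymplecticForm_isAlt K n).isRefl.nondegenerate_iff_separatingLeft.2 fun u hu => ?_
  have hne (i j : Fin n) : Fin.castAdd n i ≠ j.addNat n := by
    simp only [ne_eq, Fin.ext_iff, Fin.val_castAdd, Fin.val_addNat]
    omega
  ext l
  refine Fin.addCases (fun i => ?_) (fun i => ?_) l
  · simpa [standardSymplecticForm_apply, w0f, Pi.single_apply, hne] using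
      hu (Pi.single (Fin.natAdd n i) 1)
  · simpa [standardSymplecticForm_apply, w0f, Pi.single_apply, (hne _ _).symm] using
      hu (Pi.single (Fin.castAdd n i) 1)

/-- Every element of `matchingSpan` is a combination indexed by ordered pairs `a i < b i`. -/
theorem exists_ordered_coefficients {K V : Type*} [Field K] [AddCommGroup V] [Module K V]
    {ω : LinearMap.BilinForm K V} (halt : ω.IsAlt) {p : ℕ} {F : (Fin (2 * p) → V) → K}
    (hF : F ∈ matchingSpan ω (Fin (2 * p))) :
    ∃ c : (Fin p → Fin (2 * p)) → (Fin p → Fin (2 * p)) → K, ∀ v, F v =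
      ∑ a : Fin p → Fin (2 * p), ∑ b : Fin p → Fin (2 * p),
        if (∀ i, a i < b i) ∧ Function.Bijective (Sum.elim a b) then
          c a b * ∏ i, ω (v (a i)) (v (b i)) else 0 := by
  induction hF using Submodule.span_induction with
  | mem F hF =>
    obtain ⟨q, a, b, hab, rfl⟩ := hF
    obtain rfl : q = p := by
      have := Fintype.card_of_bijective hab
      simp only [Fintype.card_sum, Fintype.card_fin] at this
      omega
    have hne (i : Fin q) : a i ≠ b i := fun h =>
      Sum.inl_ne_inr (hab.1 (a₁ := Sum.inl i) (a₂ := Sum.inr i) h)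
    have hbij : Function.Bijective (Sum.elim (fun i => min (a i) (b i))
        fun i => max (a i) (b i)) := by
      refine (Fintype.bijective_iff_surjective_and_card _).2 ⟨fun l => ?_, by simp; omega⟩
      obtain ⟨k | k, rfl⟩ := hab.2 l <;> rcases lt_or_gt_of_ne (hne k) with h | h
      · exact ⟨Sum.inl k, by simp [h.le]⟩
      · exact ⟨Sum.inr k, by simp [h.le]⟩
      · exact ⟨Sum.inr k, by simp [h.le]⟩
      · exact ⟨Sum.inl k, by simp [h.le]⟩
    refine ⟨fun x y => if x = (fun i => min (a i) (b i)) ∧ y = (fun i => max (a i) (b i)) then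
      ∏ i, (if a i < b i then 1 else -1) else 0, fun v => ?_⟩
    rw [Finset.sum_eq_single (fun i => min (a i) (b i)),
      Finset.sum_eq_single (fun i => max (a i) (b i)), if_pos ⟨fun i => min_lt_max.2 (hne i), hbij⟩]
    · simp only [and_self, if_true]
      rw [← Finset.prod_mul_distrib]
      refine Finset.prod_congr rfl fun i _ => ?_
      rcases lt_or_gt_of_ne (hne i) with h | h
      · simp [h, h.le]
      · simp [h.le, h.not_gt, halt.neg_eq]
    · intro y _ hy
      simp [hy]
    · simp
    · intro x _ hx
      simp [hx]
    · simp
  | zero => exact ⟨0, by simp⟩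
  | add F G _ _ hF hG =>
    obtain ⟨c, hc⟩ := hF
    obtain ⟨d, hd⟩ := hG
    refine ⟨c + d, fun v => ?_⟩
    simp only [Pi.add_apply, hc, hd, ← Finset.sum_add_distrib]
    congr! 2
    split_ifs <;> ring
  | smul t F _ hF =>
    obtain ⟨c, hc⟩ := hF
    refine ⟨t • c, fun v => ?_⟩
    simp only [Pi.smul_apply, smul_eq_mul, hc, Finset.mul_sum, mul_ite, mul_zero, mul_assoc]

theorem mem_infinitesimalInvariants_standardSymplecticForm {K : Type} [Field K] [CharZero K]
    {n m : ℕ} {T : MultilinearMap K (fun _ : Fin m => (Fin (n + n) → K)) K}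
    (hinv : ∀ g : Matrix (Fin (n + n)) (Fin (n + n)) K,
      (∀ u v : Fin (n + n) → K, w0f K n (g.mulVec u) (g.mulVec v) = w0f K n u v) →
      ∀ v : Fin m → (Fin (n + n) → K), T (fun i => g.mulVec (v i)) = T v) :
    T ∈ infinitesimalInvariants (standardSymplecticForm K n) (Fin m) := by
  refine mem_infinitesimalInvariants_of_transvections fun t u v => ?_
  have hg (x : Fin (n + n) → K) :
      (LinearMap.toMatrix' (LinearMap.id +
        (t • (standardSymplecticForm K n).flip u).smulRight u)).mulVec x =
        x + (t * standardSymplecticForm K n x u) • u := by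
    rw [LinearMap.toMatrix'_mulVec]
    simp
  simp only [← hg]
  refine hinv _ (fun x y => ?_) v
  have halt := standardSymplecticForm_isAlt K n
  rw [hg, hg, ← standardSymplecticForm_apply, ← standardSymplecticForm_apply]
  simp only [map_add, map_smul, LinearMap.add_apply, LinearMap.smul_apply, smul_eq_mul,
    halt.self_eq_zero, ← halt.neg_eq y u]
  ring

/-- **First fundamental theorem of invariant theory for the symplectic group.**
Let `T : V^m → K` be a multilinear form on `V = K^{2n}` invariant under `Sp(2n,K)`. Then:
(i) if `m` is odd, `T = 0`;
(ii) if `m = 2p`, `T` is a linear combination of the forms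
`T_M(v_1,…,v_{2p}) = ∏_i ω_0(v_{a_i}, v_{b_i})` over perfect matchings
`M = {{a_1,b_1},…,{a_p,b_p}}` (`a_i < b_i`) of `{1,…,2p}`. -/
theorem fft_symplectic_group (K : Type) [Field K] [CharZero K]
    (n m : ℕ) (hn : 1 ≤ n)
    (T : MultilinearMap K (fun _ : Fin m => (Fin (n + n) → K)) K)
    (hinv : ∀ g : Matrix (Fin (n + n)) (Fin (n + n)) K,
      (∀ u v : Fin (n + n) → K, w0f K n (g.mulVec u) (g.mulVec v) = w0f K n u v) →
      ∀ v : Fin m → (Fin (n + n) → K), T (fun i => g.mulVec (v i)) = T v) :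
    (Odd m → T = 0) ∧
    (∀ (p : ℕ) (hm : m = 2 * p),
      ∃ c : (Fin p → Fin (2 * p)) → (Fin p → Fin (2 * p)) → K,
        ∀ v : Fin m → (Fin (n + n) → K),
          T v = ∑ a : Fin p → Fin (2 * p), ∑ b : Fin p → Fin (2 * p),
            if (∀ i, a i < b i) ∧ Function.Bijective (Sum.elim a b) then
              c a b * ∏ i, w0f K n (v (Fin.cast hm.symm (a i))) (v (Fin.cast hm.symm (b i)))
            else 0) := by
  have hT := coe_mem_matchingSpan (Pi.basisFun K (Fin (n + n)))
    (standardSymplecticForm_nondegenerate K n) (standardSymplecticForm_isAlt K n)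
    (mem_infinitesimalInvariants_standardSymplecticForm hinv)
  refine ⟨fun hodd => ?_, ?_⟩
  · have hempty : matchingSpan (standardSymplecticForm K n) (Fin m) = ⊥ := by
      rw [matchingSpan, Submodule.span_eq_bot]
      rintro F ⟨p, a, b, hab, -⟩
      have := Fintype.card_of_bijective hab
      simp only [Fintype.card_sum, Fintype.card_fin] at this
      exact absurd hodd (Nat.not_odd_iff_even.2 ⟨p, this.symm⟩)
    rw [hempty, Submodule.mem_bot] at hT
    exact DFunLike.coe_injective hT
  · rintro p rfl
    exact exists_ordered_coefficients (standardSymplecticForm_isAlt K n) hT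
end
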